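/- Let k ≥ 4 be an even natural number and r a natural number. If G is a (6k−4+4r)-edge-connected bipartite graph with vertex classes A_1 and A_2 and the number of edges |E(G)| is divisible by k, then the edge set of G can be decomposed into two spanning subgraphs G_1 and G_2 such that, for i = 1, 2, the subgraph G_i is r-edge-connected and the degree in G_i of every vertex of A_i is divisible by k. -/

import Mathlib

open SimpleGraph

/-- A graph `G` is `k`-edge-connected if it remains connected after the deletion of
any fewer than `k` edges. -/
def IsKEdgeConnected {V : Type} (G : SimpleGraph V) (k : ℕ) : Prop :=
  ∀ S : Finset (Sym2 V), S.card < k → (G.deleteEdges ↑S).Connected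


set_option linter.unusedSectionVars false

/-- Multigraph orientation instance with constants. -/
structure MI (V E : Type) where
  W : Finset V
  F : Finset E
  s : E → V
  t : E → V
  P : V → ℤ
  i : V → ℤ
  o : V → ℤ

namespace MI
variable {V E : Type} [DecidableEq V] [DecidableEq E]

/-- crossing indicator -/
def cr (A : Finset V) (x y : V) : ℤ := if (x ∈ A ↔ y ∈ A) then 0 else 1
/-- inside indicator -/
def ins (A : Finset V) (x y : V) : ℤ := if x ∈ A ∧ y ∈ A then 1 else 0

/-- total degree of a set -/
def D (G : MI V E) (A : Finset V) : ℤ :=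
  ∑ e ∈ G.F, cr A (G.s e) (G.t e) + ∑ v ∈ A, (G.i v + G.o v)
/-- required in-degree of a set -/
def R (G : MI V E) (A : Finset V) : ℤ :=
  ∑ v ∈ A, G.P v - ∑ e ∈ G.F, ins A (G.s e) (G.t e)

/-- interval predicate -/
def gd (k c₁ c₂ R D : ℤ) : Prop := ∃ I : ℤ, k ∣ I - R ∧ c₁ ≤ I ∧ I ≤ D - c₂

structure Valid (k : ℤ) (G : MI V E) : Prop where
  hs : ∀ e ∈ G.F, G.s e ∈ G.W
  ht : ∀ e ∈ G.F, G.t e ∈ G.W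
  hi : ∀ v, 0 ≤ G.i v
  ho : ∀ v, 0 ≤ G.o v
  sum : k ∣ ∑ v ∈ G.W, G.P v - G.F.card - ∑ v ∈ G.W, G.i v
  two : (∑ v ∈ G.W, G.i v ≤ k - 1 ∧ ∑ v ∈ G.W, G.o v ≤ 2 * k - 1) ∨
        (∑ v ∈ G.W, G.i v ≤ 2 * k - 1 ∧ ∑ v ∈ G.W, G.o v ≤ k - 1)

def isSol (k : ℤ) (G : MI V E) (h : E → V) : Prop :=
  (∀ e ∈ G.F, h e = G.s e ∨ h e = G.t e) ∧
  ∀ v ∈ G.W, k ∣ G.P v - G.i v - ∑ e ∈ G.F, if h e = v then (1:ℤ) else 0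

def Sol (k : ℤ) (G : MI V E) : Prop := ∃ h, isSol k G h

lemma gd_mono {k c₁ c₂ R D c₁' c₂' R' D' : ℤ} (a b : ℤ) (h : gd k c₁ c₂ R D)
    (hR : R' = R - a) (hD : D' = D - a - b) (h1 : c₁' ≤ c₁ - a) (h2 : c₂' ≤ c₂ - b) :
    gd k c₁' c₂' R' D' := by
  obtain ⟨I, h0, hl, hu⟩ := h
  refine ⟨I - a, ?_, by linarith, by linarith⟩
  subst hR
  convert h0 using 1; ring

/-! ### operations -/

def opIn (G : MI V E) (v : V) (q : ℤ) : MI V E :=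
  { G with i := Function.update G.i v (G.i v + q), P := Function.update G.P v (G.P v + q) }
def opOut (G : MI V E) (v : V) (q : ℤ) : MI V E :=
  { G with o := Function.update G.o v (G.o v + q) }
def opDel (G : MI V E) (e : E) (y : V) : MI V E :=
  { G with s := Function.update G.s e y, t := Function.update G.t e y }
def opLift (G : MI V E) (e₁ e₂ : E) (y x₁ x₂ : V) : MI V E :=
  { G with s := Function.update (Function.update G.s e₁ x₁) e₂ y,
           t := Function.update (Function.update G.t e₁ x₂) e₂ y }

lemma sum_upd (f : V → ℤ) (A : Finset V) (v : V) (q : ℤ) :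
    ∑ x ∈ A, Function.update f v (f v + q) x = ∑ x ∈ A, f x + if v ∈ A then q else 0 := by
  have : ∀ x, Function.update f v (f v + q) x = f x + if v = x then q else 0 := by
    intro x; by_cases h : v = x
    · subst h; simp
    · simp [h, Function.update_of_ne (Ne.symm h)]
  simp [this, Finset.sum_add_distrib]

lemma sum_chg {F : Finset E} {f g : E → ℤ} {e : E} (he : e ∈ F) (h : ∀ e' ≠ e, f e' = g e') :
    ∑ x ∈ F, f x = ∑ x ∈ F, g x + f e - g e := by
  rw [← Finset.add_sum_erase F f he, ← Finset.add_sum_erase F g he]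
  rw [Finset.sum_congr rfl (fun x hx => h x (Finset.ne_of_mem_erase hx))]
  ring

lemma D_opIn (G : MI V E) (v : V) (q : ℤ) (A : Finset V) :
    (G.opIn v q).D A = G.D A + if v ∈ A then q else 0 := by
  simp only [D, opIn, Finset.sum_add_distrib, sum_upd]; ring
lemma R_opIn (G : MI V E) (v : V) (q : ℤ) (A : Finset V) :
    (G.opIn v q).R A = G.R A + if v ∈ A then q else 0 := by
  simp only [R, opIn, sum_upd]; ring
lemma D_opOut (G : MI V E) (v : V) (q : ℤ) (A : Finset V) :
    (G.opOut v q).D A = G.D A + if v ∈ A then q else 0 := by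
  simp only [D, opOut, Finset.sum_add_distrib, sum_upd]; ring
lemma R_opOut (G : MI V E) (v : V) (q : ℤ) (A : Finset V) :
    (G.opOut v q).R A = G.R A := rfl

/-- the edge `e` joins `x` and `y` -/
def Jn (G : MI V E) (e : E) (x y : V) : Prop :=
  (G.s e = x ∧ G.t e = y) ∨ (G.s e = y ∧ G.t e = x)

lemma cr_jn {G : MI V E} {e : E} {x y : V} (h : G.Jn e x y) (A : Finset V) :
    cr A (G.s e) (G.t e) = cr A x y := by
  rcases h with ⟨h1, h2⟩ | ⟨h1, h2⟩ <;> rw [h1, h2]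
  simp only [cr]; congr 1; exact propext Iff.comm
lemma ins_jn {G : MI V E} {e : E} {x y : V} (h : G.Jn e x y) (A : Finset V) :
    ins A (G.s e) (G.t e) = ins A x y := by
  rcases h with ⟨h1, h2⟩ | ⟨h1, h2⟩ <;> rw [h1, h2]
  simp only [ins]; congr 1; exact propext And.comm

lemma D_opDel {G : MI V E} {e : E} {x y : V} (he : e ∈ G.F) (h : G.Jn e x y) (A : Finset V) :
    (G.opDel e y).D A = G.D A - cr A x y := by
  simp only [D, opDel]
  rw [sum_chg he (g := fun e => cr A (G.s e) (G.t e))]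
  · rw [cr_jn h]; simp [cr]; ring
  · intro e' h'; simp [Function.update_of_ne h']
lemma R_opDel {G : MI V E} {e : E} {x y : V} (he : e ∈ G.F) (h : G.Jn e x y) (A : Finset V) :
    (G.opDel e y).R A = G.R A + ins A x y - if y ∈ A then 1 else 0 := by
  simp only [R, opDel]
  rw [sum_chg he (g := fun e => ins A (G.s e) (G.t e))]
  · rw [ins_jn h]; simp [ins]; ring
  · intro e' h'; simp [Function.update_of_ne h']

lemma D_opLift {G : MI V E} {e₁ e₂ : E} {y x₁ x₂ : V} (he₁ : e₁ ∈ G.F) (he₂ : e₂ ∈ G.F)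
    (hne : e₁ ≠ e₂)
    (h₁ : G.Jn e₁ x₁ y) (h₂ : G.Jn e₂ x₂ y) (A : Finset V) :
    (G.opLift e₁ e₂ y x₁ x₂).D A = G.D A - cr A x₁ y - cr A x₂ y + cr A x₁ x₂ := by
  simp only [D, opLift]
  rw [sum_chg he₂ (g := fun e => cr A (Function.update G.s e₁ x₁ e) (Function.update G.t e₁ x₂ e)),
    sum_chg he₁ (g := fun e => cr A (G.s e) (G.t e))]
  · rw [cr_jn h₁]; simp [Function.update_of_ne (Ne.symm hne), cr_jn h₂]
    have : cr A y y = 0 := by simp [cr]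
    rw [this]; ring
  · intro e' h'; simp [Function.update_of_ne h']
  · intro e' h'; simp [Function.update_of_ne h']
lemma R_opLift {G : MI V E} {e₁ e₂ : E} {y x₁ x₂ : V} (he₁ : e₁ ∈ G.F) (he₂ : e₂ ∈ G.F)
    (hne : e₁ ≠ e₂)
    (h₁ : G.Jn e₁ x₁ y) (h₂ : G.Jn e₂ x₂ y) (A : Finset V) :
    (G.opLift e₁ e₂ y x₁ x₂).R A =
      G.R A + ins A x₁ y + ins A x₂ y - ins A x₁ x₂ - if y ∈ A then 1 else 0 := by
  simp only [R, opLift]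
  rw [sum_chg he₂ (g := fun e => ins A (Function.update G.s e₁ x₁ e) (Function.update G.t e₁ x₂ e)),
    sum_chg he₁ (g := fun e => ins A (G.s e) (G.t e))]
  · rw [ins_jn h₁]; simp [Function.update_of_ne (Ne.symm hne), ins_jn h₂]
    have : ins A y y = if y ∈ A then 1 else 0 := by simp [ins]
    rw [this]; ring
  · intro e' h'; simp [Function.update_of_ne h']
  · intro e' h'; simp [Function.update_of_ne h']

/-! solutions transfer -/
lemma sol_opIn {k : ℤ} {G : MI V E} {v : V} {q : ℤ} (h : Sol k (G.opIn v q)) : Sol k G := by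
  obtain ⟨f, h1, h2⟩ := h
  refine ⟨f, h1, fun u hu => ?_⟩
  have := h2 u hu
  by_cases huv : u = v
  · subst huv; simp [opIn] at this; simpa using this
  · simpa [opIn, Function.update_of_ne huv] using this
lemma sol_opOut {k : ℤ} {G : MI V E} {v : V} {q : ℤ} (h : Sol k (G.opOut v q)) : Sol k G := h

lemma sol_opDel {k : ℤ} {G : MI V E} {e : E} {x y : V} (hj : G.Jn e x y)
    (h : Sol k (G.opDel e y)) : Sol k G := by
  obtain ⟨f, h1, h2⟩ := h
  refine ⟨f, fun e' he' => ?_, h2⟩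
  have := h1 e' he'
  by_cases hee : e' = e
  · subst hee
    simp [opDel] at this
    rcases hj with ⟨ha, hb⟩ | ⟨ha, hb⟩
    · right; rw [this, hb]
    · left; rw [this, ha]
  · simpa [opDel, Function.update_of_ne hee] using this

lemma sol_opLift {k : ℤ} {G : MI V E} {e₁ e₂ : E} {y x₁ x₂ : V}
    (he₁ : e₁ ∈ G.F) (he₂ : e₂ ∈ G.F) (hne : e₁ ≠ e₂)
    (h₁ : G.Jn e₁ x₁ y) (h₂ : G.Jn e₂ x₂ y)
    (h : Sol k (G.opLift e₁ e₂ y x₁ x₂)) : Sol k G := by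
  obtain ⟨f, hf1, hf2⟩ := h
  have hy : f e₂ = y := by
    have := hf1 e₂ he₂
    simpa [opLift] using this
  by_cases hx : f e₁ = x₁
  · refine ⟨f, fun e' he' => ?_, hf2⟩
    by_cases h1 : e' = e₁
    · subst h1; rw [hx]; rcases h₁ with ⟨ha, hb⟩ | ⟨ha, hb⟩ <;> simp [ha, hb]
    · by_cases h2 : e' = e₂
      · subst h2; rw [hy]; rcases h₂ with ⟨ha, hb⟩ | ⟨ha, hb⟩ <;> simp [ha, hb]
      · have := hf1 e' he'
        simpa [opLift, Function.update_of_ne h1, Function.update_of_ne h2] using this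
  · have hx2 : f e₁ = x₂ := by
      have := hf1 e₁ he₁
      simp [opLift, Function.update_of_ne hne] at this
      tauto
    refine ⟨Function.update (Function.update f e₁ y) e₂ x₂, fun e' he' => ?_, fun v hv => ?_⟩
    · by_cases h2 : e' = e₂
      · subst h2; simp; rcases h₂ with ⟨ha, hb⟩ | ⟨ha, hb⟩ <;> simp [ha, hb]
      · by_cases h1 : e' = e₁
        · subst h1; simp [Function.update_of_ne h2]
          rcases h₁ with ⟨ha, hb⟩ | ⟨ha, hb⟩ <;> simp [ha, hb]
        · have := hf1 e' he'
          simpa [opLift, Function.update_of_ne h1, Function.update_of_ne h2] using this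
    · have hs : ∑ e ∈ G.F, (if Function.update (Function.update f e₁ y) e₂ x₂ e = v then (1:ℤ) else 0)
          = ∑ e ∈ G.F, if f e = v then (1:ℤ) else 0 := by
        rw [sum_chg he₂ (g := fun e => if Function.update f e₁ y e = v then (1:ℤ) else 0),
          sum_chg he₁ (g := fun e => if f e = v then (1:ℤ) else 0)]
        · simp [Function.update_of_ne (Ne.symm hne), hx2, hy]
        · intro e' h'; simp [Function.update_of_ne h']
        · intro e' h'; simp [Function.update_of_ne h']
      rw [hs]; exact hf2 v hv

end MI

set_option linter.unusedSectionVars false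
namespace MI
variable {V E : Type} [DecidableEq V] [DecidableEq E]

/-! ### contraction -/
def phi (A : Finset V) (a v : V) : V := if v ∈ A then a else v
def con (G : MI V E) (A : Finset V) (a : V) : MI V E where
  W := insert a (G.W \ A)
  F := G.F
  s := fun e => phi A a (G.s e)
  t := fun e => phi A a (G.t e)
  P := fun v => if v = a then ∑ x ∈ A, G.P x else G.P v
  i := fun v => if v = a then ∑ x ∈ A, G.i x else G.i v
  o := fun v => if v = a then ∑ x ∈ A, G.o x else G.o v

def pre (A : Finset V) (a : V) (B : Finset V) : Finset V := if a ∈ B then B ∪ A else B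

lemma phi_mem {A W B : Finset V} {a : V} (hB : B ⊆ insert a (W \ A)) (ha : a ∈ A) (x : V) :
    phi A a x ∈ B ↔ x ∈ pre A a B := by
  unfold phi pre
  by_cases hx : x ∈ A
  · by_cases hb : a ∈ B
    · simp [hx, hb]
    · simp only [hx, hb, if_true, if_false, false_iff]
      intro h
      have := hB h
      simp [hx] at this
      subst this; exact hb h
  · by_cases hb : a ∈ B <;> simp [hx, hb]

lemma sum_con {A W B : Finset V} {a : V} (hB : B ⊆ insert a (W \ A)) (ha : a ∈ A) (f : V → ℤ) :
    ∑ v ∈ B, (if v = a then ∑ x ∈ A, f x else f v) = ∑ v ∈ pre A a B, f v := by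
  unfold pre
  by_cases hb : a ∈ B
  · rw [if_pos hb, ← Finset.add_sum_erase B _ hb]
    simp only [if_true]
    have h1 : B ∪ A = (B.erase a) ∪ A := by
      ext x; simp only [Finset.mem_union, Finset.mem_erase]
      by_cases hx : x = a
      · subst hx; simp [ha]
      · simp [hx]
    have h2 : Disjoint (B.erase a) A := by
      rw [Finset.disjoint_left]; intro x hx
      have := hB (Finset.mem_of_mem_erase hx)
      simp [Finset.ne_of_mem_erase hx] at this
      exact this.2
    rw [h1, Finset.sum_union h2, add_comm]
    congr 1
    exact Finset.sum_congr rfl (fun x hx => by simp [Finset.ne_of_mem_erase hx])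
  · rw [if_neg hb]
    exact Finset.sum_congr rfl (fun x hx => by
      have : x ≠ a := fun h => hb (h ▸ hx)
      simp [this])

lemma D_con {G : MI V E} {A B : Finset V} {a : V} (hB : B ⊆ (G.con A a).W) (ha : a ∈ A) :
    (G.con A a).D B = G.D (pre A a B) := by
  have hB' : B ⊆ insert a (G.W \ A) := hB
  unfold D
  simp only [Finset.sum_add_distrib]
  congr 1
  · exact Finset.sum_congr rfl (fun e _ => by simp [cr, con, phi_mem hB' ha])
  · simp only [con]; rw [sum_con hB' ha, sum_con hB' ha]
lemma R_con {G : MI V E} {A B : Finset V} {a : V} (hB : B ⊆ (G.con A a).W) (ha : a ∈ A) :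
    (G.con A a).R B = G.R (pre A a B) := by
  have hB' : B ⊆ insert a (G.W \ A) := hB
  unfold R
  congr 1
  · simp only [con]; rw [sum_con hB' ha]
  · exact Finset.sum_congr rfl (fun e _ => by simp [ins, con, phi_mem hB' ha])

lemma pre_W {G : MI V E} {A : Finset V} {a : V} (hA : A ⊆ G.W) (ha : a ∈ A) :
    pre A a (G.con A a).W = G.W := by
  simp only [pre, con, Finset.mem_insert_self, if_true]
  ext x; simp only [Finset.mem_union, Finset.mem_insert, Finset.mem_sdiff]
  by_cases hx : x ∈ A
  · simp [hx, hA hx]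
  · simp only [hx, not_false_eq_true, and_true, or_false]
    constructor
    · rintro (rfl | h)
      · exact hA ha
      · exact h
    · exact Or.inr

lemma pre_sub {G : MI V E} {A B : Finset V} {a : V} (hA : A ⊆ G.W) (ha : a ∈ A)
    (hB : B ⊆ (G.con A a).W) : pre A a B ⊆ G.W := by
  intro x hx
  rw [← phi_mem hB ha] at hx
  unfold phi at hx
  split_ifs at hx with h
  · exact hA h
  · have := hB hx
    simp only [con, Finset.mem_insert, Finset.mem_sdiff] at this
    rcases this with rfl | h'
    · exact hA ha
    · exact h'.1

lemma sub_pre {A B : Finset V} {a : V} : B ⊆ pre A a B := by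
  unfold pre; split_ifs
  · exact Finset.subset_union_left
  · exact subset_rfl

lemma pre_ne {G : MI V E} {A B : Finset V} {a : V} (hA : A ⊆ G.W) (ha : a ∈ A)
    (hB : B ⊆ (G.con A a).W) (hne : B ≠ (G.con A a).W) : pre A a B ≠ G.W := by
  intro h
  apply hne
  apply Finset.Subset.antisymm hB
  intro x hx
  simp only [con, Finset.mem_insert, Finset.mem_sdiff] at hx
  have hx' : phi A a x = x := by
    unfold phi; rcases hx with rfl | hx
    · simp
    · simp [hx.2]
  rw [← hx', phi_mem hB ha, h]
  rcases hx with rfl | hx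
  · exact hA ha
  · exact hx.1

lemma valid_con {k : ℤ} {G : MI V E} {A : Finset V} {a : V} (hG : Valid k G) (hA : A ⊆ G.W)
    (ha : a ∈ A) : Valid k (G.con A a) := by
  have key : ∀ x ∈ G.W, phi A a x ∈ (G.con A a).W := by
    intro x hx; unfold phi; simp only [con]; split_ifs with h
    · simp
    · simp [h, hx]
  have hW : ∀ f : V → ℤ, ∑ v ∈ (G.con A a).W, (if v = a then ∑ x ∈ A, f x else f v)
      = ∑ v ∈ G.W, f v := by
    intro f
    rw [sum_con (W := G.W) (B := (G.con A a).W) subset_rfl ha f, pre_W hA ha]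
  refine ⟨fun e he => key _ (hG.hs e he), fun e he => key _ (hG.ht e he), ?_, ?_, ?_, ?_⟩
  · intro v; simp only [con]; split_ifs
    · exact Finset.sum_nonneg (fun x _ => hG.hi x)
    · exact hG.hi v
  · intro v; simp only [con]; split_ifs
    · exact Finset.sum_nonneg (fun x _ => hG.ho x)
    · exact hG.ho v
  · have := hG.sum
    rw [← hW, ← hW] at this; exact this
  · have := hG.two
    rw [← hW, ← hW] at this; exact this

lemma card_con {G : MI V E} {A : Finset V} {a : V} (hA : A ⊆ G.W) (ha : a ∈ A)
    (h2 : 2 ≤ A.card) : (G.con A a).W.card < G.W.card := by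
  simp only [con]
  rw [Finset.card_insert_of_notMem (by simp [ha]), Finset.card_sdiff_of_subset hA]
  have := Finset.card_le_card hA
  omega

/-! ### the inner instance -/
def pt (G : MI V E) (A : Finset V) (e : E) : V := if G.s e ∈ A then G.s e else G.t e
def ot (G : MI V E) (A : Finset V) (e : E) : V := if G.s e ∈ A then G.t e else G.s e
def inn (G : MI V E) (A : Finset V) (a : V) (h : E → V) : MI V E where
  W := A
  F := G.F.filter (fun e => G.s e ∈ A ∧ G.t e ∈ A)
  s := G.s
  t := G.t
  P := G.P
  i := fun v => G.i v + ∑ e ∈ G.F,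
    if ¬ (G.s e ∈ A ↔ G.t e ∈ A) ∧ G.pt A e = v ∧ h e = a then (1:ℤ) else 0
  o := fun v => G.o v + ∑ e ∈ G.F,
    if ¬ (G.s e ∈ A ↔ G.t e ∈ A) ∧ G.pt A e = v ∧ h e ≠ a then (1:ℤ) else 0

lemma D_inn {G : MI V E} {A B : Finset V} {a : V} {h : E → V} (hB : B ⊆ A) :
    (G.inn A a h).D B = G.D B := by
  unfold D
  simp only [inn, Finset.sum_add_distrib]
  rw [Finset.sum_comm (s := B), Finset.sum_comm (s := B), Finset.sum_filter]
  have : ∑ e ∈ G.F, (if G.s e ∈ A ∧ G.t e ∈ A then cr B (G.s e) (G.t e) else 0)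
     + ∑ e ∈ G.F, ∑ v ∈ B, (if ¬ (G.s e ∈ A ↔ G.t e ∈ A) ∧ G.pt A e = v ∧ h e = a then (1:ℤ) else 0)
     + ∑ e ∈ G.F, ∑ v ∈ B, (if ¬ (G.s e ∈ A ↔ G.t e ∈ A) ∧ G.pt A e = v ∧ h e ≠ a then (1:ℤ) else 0)
     = ∑ e ∈ G.F, cr B (G.s e) (G.t e) := by
    rw [← Finset.sum_add_distrib, ← Finset.sum_add_distrib]
    refine Finset.sum_congr rfl (fun e _ => ?_)
    have h1 : G.s e ∈ B → G.s e ∈ A := fun h => hB h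
    have h2 : G.t e ∈ B → G.t e ∈ A := fun h => hB h
    by_cases hs : G.s e ∈ A <;> by_cases ht : G.t e ∈ A <;> by_cases hh : h e = a <;>
      simp [hs, ht, hh, pt, cr] <;>
      grind
  linarith

lemma R_inn {G : MI V E} {A B : Finset V} {a : V} {h : E → V} (hB : B ⊆ A) :
    (G.inn A a h).R B = G.R B := by
  unfold R
  simp only [inn]
  rw [Finset.sum_filter]
  congr 1
  refine Finset.sum_congr rfl (fun e _ => ?_)
  unfold ins
  by_cases h1 : G.s e ∈ B ∧ G.t e ∈ B
  · simp [h1, hB h1.1, hB h1.2]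
  · simp [h1]

lemma valid_inn {k : ℤ} {G : MI V E} {A : Finset V} {a : V} {h : E → V} (hk : 0 < k)
    (hG : Valid k G) (ha : a ∈ A) (hsol : isSol k (G.con A a) h)
    (htight : ¬ gd k k k (G.R A) (G.D A)) : Valid k (G.inn A a h) := by
  have hi : ∀ v, 0 ≤ (G.inn A a h).i v := fun v => add_nonneg (hG.hi v)
    (Finset.sum_nonneg (fun e _ => by split_ifs <;> norm_num))
  have ho : ∀ v, 0 ≤ (G.inn A a h).o v := fun v => add_nonneg (hG.ho v)
    (Finset.sum_nonneg (fun e _ => by split_ifs <;> norm_num))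
  have hsum : k ∣ ∑ v ∈ (G.inn A a h).W, (G.inn A a h).P v - (G.inn A a h).F.card
      - ∑ v ∈ (G.inn A a h).W, (G.inn A a h).i v := by
    have h1 := hsol.2 a (by simp [con])
    simp only [con, if_true] at h1
    simp only [inn, Finset.sum_add_distrib]
    rw [Finset.sum_comm (s := A), Finset.card_filter]
    push_cast
    convert h1 using 1
    have : ∑ e ∈ G.F, (if G.s e ∈ A ∧ G.t e ∈ A then (1:ℤ) else 0)
     + ∑ e ∈ G.F, ∑ v ∈ A, (if ¬ (G.s e ∈ A ↔ G.t e ∈ A) ∧ G.pt A e = v ∧ h e = a then (1:ℤ) else 0)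
     = ∑ e ∈ G.F, if h e = a then 1 else 0 := by
      rw [← Finset.sum_add_distrib]
      refine Finset.sum_congr rfl (fun e he => ?_)
      have := hsol.1 e he
      simp only [con, phi] at this
      by_cases hs : G.s e ∈ A <;> by_cases ht : G.t e ∈ A <;> by_cases hh : h e = a <;>
        simp [hs, ht, hh, pt] at this ⊢ <;> grind
    linarith
  refine ⟨?_, ?_, hi, ho, hsum, ?_⟩
  · intro e he; simp [inn] at he ⊢; exact he.2.1
  · intro e he; simp [inn] at he ⊢; exact he.2.2
  · have hI := Finset.sum_nonneg (s := A) (fun v _ => hi v)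
    have hO := Finset.sum_nonneg (s := A) (fun v _ => ho v)
    have hc : k ∣ ∑ v ∈ A, (G.inn A a h).i v - G.R A := by
      have e1 : G.R A = ∑ v ∈ (G.inn A a h).W, (G.inn A a h).P v - (G.inn A a h).F.card := by
        unfold R; simp only [inn, Finset.card_filter, ins]; push_cast; rfl
      rw [e1]
      have := (dvd_neg.mpr hsum)
      rw [neg_sub] at this
      exact this
    have hD : G.D A = ∑ v ∈ A, (G.inn A a h).i v + ∑ v ∈ A, (G.inn A a h).o v := by
      rw [← D_inn (a := a) (h := h) (subset_refl A)]
      unfold D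
      rw [Finset.sum_add_distrib, Finset.sum_eq_zero, zero_add]
      intro e he
      simp [inn] at he
      simp [cr, inn, he.2.1, he.2.2]
    change (∑ v ∈ A, (G.inn A a h).i v ≤ _ ∧ ∑ v ∈ A, (G.inn A a h).o v ≤ _) ∨
      (∑ v ∈ A, (G.inn A a h).i v ≤ _ ∧ ∑ v ∈ A, (G.inn A a h).o v ≤ _)
    rw [hD] at htight
    generalize ∑ v ∈ A, (G.inn A a h).i v = I at *
    generalize ∑ v ∈ A, (G.inn A a h).o v = O at *
    have t0 : ¬ (k ≤ I ∧ k ≤ O) := fun hh => htight ⟨I, hc, by linarith, by linarith⟩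
    have t1 : ¬ (2 * k ≤ O) := fun hh => htight ⟨I + k, by
      have := dvd_add hc (dvd_refl k)
      rwa [show I + k - G.R A = I - G.R A + k by ring], by linarith, by linarith⟩
    have t2 : ¬ (2 * k ≤ I) := fun hh => htight ⟨I - k, by
      have := dvd_sub hc (dvd_refl k)
      rwa [show I - k - G.R A = I - G.R A - k by ring], by linarith, by linarith⟩
    by_cases hI' : k ≤ I
    · right; constructor <;> by_contra hh <;> push Not at * <;> grind
    · left; constructor <;> linarith

lemma combine {k : ℤ} {G : MI V E} {A : Finset V} {a : V} {h : E → V}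
    (ha : a ∈ A) (hsol : isSol k (G.con A a) h)
    (hin : Sol k (G.inn A a h)) : Sol k G := by
  obtain ⟨g, hg1, hg2⟩ := hin
  have hg1' : ∀ e ∈ G.F, G.s e ∈ A → G.t e ∈ A → (g e = G.s e ∨ g e = G.t e) :=
    fun e he hs ht => hg1 e (by simp [inn, he, hs, ht])
  have ho : ∀ e ∈ G.F, h e = phi A a (G.s e) ∨ h e = phi A a (G.t e) := hsol.1
  refine ⟨fun e => if G.s e ∈ A ∧ G.t e ∈ A then g e else
    if ¬ (G.s e ∈ A ↔ G.t e ∈ A) then (if h e = a then G.pt A e else G.ot A e) else h e,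
    fun e he => ?_, fun v hv => ?_⟩
  · have h1 := hg1' e he
    have h2 := ho e he
    unfold phi at h2
    by_cases hs : G.s e ∈ A <;> by_cases ht : G.t e ∈ A <;> by_cases hh : h e = a <;>
        simp [hs, ht, hh, pt, ot] at h1 h2 ⊢ <;> grind
  · by_cases hvA : v ∈ A
    · have h1 := hg2 v hvA
      simp only [inn, Finset.sum_filter] at h1
      convert h1 using 1
      rw [← sub_sub, sub_sub (G.P v - G.i v), ← Finset.sum_add_distrib]
      congr 1
      refine Finset.sum_congr rfl (fun e he => ?_)
      have h1 := hg1' e he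
      have h2 := ho e he
      unfold phi at h2
      by_cases hs : G.s e ∈ A <;> by_cases ht : G.t e ∈ A <;> by_cases hh : h e = a <;>
        simp [hs, ht, hh, pt, ot] at h1 h2 ⊢ <;> grind
    · have hva : v ≠ a := fun h => hvA (h ▸ ha)
      have h1 := hsol.2 v (by simp [con, hv, hvA])
      simp only [con, if_neg hva] at h1
      convert h1 using 2
      refine Finset.sum_congr rfl (fun e he => ?_)
      have h1 := hg1' e he
      have h2 := ho e he
      unfold phi at h2
      by_cases hs : G.s e ∈ A <;> by_cases ht : G.t e ∈ A <;> by_cases hh : h e = a <;>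
        simp [hs, ht, hh, pt, ot] at h1 h2 ⊢ <;> grind

end MI

set_option linter.unusedSectionVars false
namespace MI
variable {V E : Type} [DecidableEq V] [DecidableEq E]

lemma dvdc {k a b : ℤ} (h : k ∣ a) (e : b = a) : k ∣ b := e ▸ h

def Good (k : ℤ) (G : MI V E) (A : Finset V) : Prop := gd k (k-1) (k-1) (G.R A) (G.D A)
def Loose (k : ℤ) (G : MI V E) (A : Finset V) : Prop := gd k k k (G.R A) (G.D A)

def ThyT (k : ℤ) (G : MI V E) : Prop := Valid k G ∧ G.W.Nonempty ∧
  ∀ A ⊆ G.W, A.Nonempty → (∃ z ∈ G.W, z ∉ A) → Good k G A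
def ThyP (k : ℤ) (G : MI V E) (y : V) (m : ℤ) : Prop := Valid k G ∧ y ∈ G.W ∧
  (∃ x ∈ G.W, x ≠ y) ∧ G.D {y} = 2 * m ∧ k ∣ m - G.R {y} ∧ G.i y ≤ m ∧ G.o y ≤ m ∧
  ∀ A ⊆ G.W, (∃ x ∈ A, x ≠ y) → (∃ z ∈ G.W, z ∉ A ∧ z ≠ y) → Good k G A

lemma insY_D (G : MI V E) {A : Finset V} {y : V} (hy : y ∉ A) :
    G.D (insert y A) = G.D A + G.D {y} - 2 * ∑ e ∈ G.F,
      (if G.s e ∈ insert y A ∧ G.t e ∈ insert y A then cr {y} (G.s e) (G.t e) else 0) := by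
  have : ∑ e ∈ G.F, cr (insert y A) (G.s e) (G.t e) =
    ∑ e ∈ G.F, cr A (G.s e) (G.t e) + ∑ e ∈ G.F, cr {y} (G.s e) (G.t e) - 2 * ∑ e ∈ G.F,
      (if G.s e ∈ insert y A ∧ G.t e ∈ insert y A then cr {y} (G.s e) (G.t e) else 0) := by
    rw [Finset.mul_sum, ← Finset.sum_add_distrib, ← Finset.sum_sub_distrib]
    refine Finset.sum_congr rfl (fun e _ => ?_)
    by_cases h1 : G.s e = y <;> by_cases h2 : G.t e = y <;> by_cases h3 : G.s e ∈ A <;>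
      by_cases h4 : G.t e ∈ A <;> simp [cr, h1, h2, h3, h4] <;> grind
  unfold D
  rw [this, Finset.sum_insert hy, Finset.sum_singleton]; ring
lemma insY_R (G : MI V E) {A : Finset V} {y : V} (hy : y ∉ A) :
    G.R (insert y A) = G.R A + G.R {y} - ∑ e ∈ G.F,
      (if G.s e ∈ insert y A ∧ G.t e ∈ insert y A then cr {y} (G.s e) (G.t e) else 0) := by
  have : ∑ e ∈ G.F, ins (insert y A) (G.s e) (G.t e) =
    ∑ e ∈ G.F, ins A (G.s e) (G.t e) + ∑ e ∈ G.F, ins {y} (G.s e) (G.t e) + ∑ e ∈ G.F,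
      (if G.s e ∈ insert y A ∧ G.t e ∈ insert y A then cr {y} (G.s e) (G.t e) else 0) := by
    rw [← Finset.sum_add_distrib, ← Finset.sum_add_distrib]
    refine Finset.sum_congr rfl (fun e _ => ?_)
    by_cases h1 : G.s e = y <;> by_cases h2 : G.t e = y <;> by_cases h3 : G.s e ∈ A <;>
      by_cases h4 : G.t e ∈ A <;> simp [cr, ins, h1, h2, h3, h4] <;> grind
  unfold R
  rw [this, Finset.sum_insert hy, Finset.sum_singleton]; ring

lemma mem_con_phi {G : MI V E} {A : Finset V} {a x : V} (hx : x ∈ (G.con A a).W) :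
    phi A a x = x := by
  simp only [con, Finset.mem_insert, Finset.mem_sdiff] at hx
  unfold phi; rcases hx with rfl | hx
  · simp
  · simp [hx.2]
lemma notMem_pre {G : MI V E} {A B : Finset V} {a x : V} (hB : B ⊆ (G.con A a).W) (ha : a ∈ A)
    (hx : x ∈ (G.con A a).W) (hxB : x ∉ B) : x ∉ pre A a B := by
  rw [← phi_mem hB ha, mem_con_phi hx]; exact hxB
lemma con_W_sub {G : MI V E} {A : Finset V} {a x : V} (hA : A ⊆ G.W) (ha : a ∈ A)
    (hx : x ∈ (G.con A a).W) : x ∈ G.W := by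
  simp only [con, Finset.mem_insert, Finset.mem_sdiff] at hx
  rcases hx with rfl | hx
  · exact hA ha
  · exact hx.1

/-- contraction step for T -/
lemma T_contract {k : ℤ} (hk : 0 < k) {G : MI V E} (hT : ThyT k G)
    (IH : ∀ H : MI V E, H.W.card < G.W.card → ThyT k H → Sol k H)
    {A : Finset V} (hA : A ⊆ G.W) (h2 : 2 ≤ A.card) (hz : ∃ z ∈ G.W, z ∉ A)
    (ht : ¬ Loose k G A) : Sol k G := by
  obtain ⟨hV, hne, hG⟩ := hT
  obtain ⟨a, ha⟩ := Finset.card_pos.mp (by omega : 0 < A.card)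
  obtain ⟨h, hsol⟩ := IH (G.con A a) (card_con hA ha h2) ⟨valid_con hV hA ha, ⟨a, by simp [con]⟩, by
    intro B hB hBn ⟨z, hzW, hzB⟩
    unfold Good
    rw [D_con hB ha, R_con hB ha]
    exact hG _ (pre_sub hA ha hB) (hBn.mono sub_pre) ⟨z, con_W_sub hA ha hzW, notMem_pre hB ha hzW hzB⟩⟩
  refine combine ha hsol (IH _ ?_ ⟨valid_inn hk hV ha hsol ht, ⟨a, ha⟩, ?_⟩)
  · obtain ⟨z, hz1, hz2⟩ := hz
    exact Finset.card_lt_card ⟨hA, fun h => hz2 (h hz1)⟩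
  · intro B hB hBn ⟨z, hzW, hzB⟩
    have hB' : B ⊆ A := hB
    unfold Good
    rw [D_inn hB', R_inn hB']
    exact hG B (hB'.trans hA) hBn ⟨z, hA hzW, hzB⟩

lemma P_contract1 {k : ℤ} (hk : 0 < k) {G : MI V E} {y : V} {m : ℤ} (hT : ThyP k G y m)
    (IH : ∀ H : MI V E, H.W.card < G.W.card → ThyT k H → Sol k H)
    (IHP : ∀ H : MI V E, H.W.card < G.W.card → ∀ y m, ThyP k H y m → Sol k H)
    {A : Finset V} (hA : A ⊆ G.W) (h2 : 2 ≤ A.card) (hyA : y ∉ A)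
    (hz : ∃ z ∈ G.W, z ∉ A ∧ z ≠ y)
    (ht : ¬ Loose k G A) : Sol k G := by
  obtain ⟨hV, hyW, hne, hD, hR, hiy, hoy, hG⟩ := hT
  obtain ⟨a, ha⟩ := Finset.card_pos.mp (by omega : 0 < A.card)
  have hay : a ≠ y := fun h => hyA (h ▸ ha)
  have hyc : y ∈ (G.con A a).W := by simp [con, hyW, hyA]
  have hpy : pre A a {y} = {y} := by simp [pre, hay]
  obtain ⟨h, hsol⟩ := IHP (G.con A a) (card_con hA ha h2) y m ⟨valid_con hV hA ha, hyc,
    ⟨a, by simp [con], hay⟩, by rw [D_con (by simpa using hyc) ha, hpy, hD],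
    by rw [R_con (by simpa using hyc) ha, hpy]; exact hR,
    by simpa [con, hay.symm] using hiy, by simpa [con, hay.symm] using hoy, by
    rintro B hB ⟨x, hx, hxy⟩ ⟨z, hzW, hzB, hzy⟩
    unfold Good
    rw [D_con hB ha, R_con hB ha]
    exact hG _ (pre_sub hA ha hB) ⟨x, sub_pre hx, hxy⟩
      ⟨z, con_W_sub hA ha hzW, notMem_pre hB ha hzW hzB, hzy⟩⟩
  refine combine ha hsol (IH _ ?_ ⟨valid_inn hk hV ha hsol ht, ⟨a, ha⟩, ?_⟩)
  · exact Finset.card_lt_card ⟨hA, fun h => hyA (h hyW)⟩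
  · rintro B hB ⟨x, hx⟩ ⟨z, hzW, hzB⟩
    have hB' : B ⊆ A := hB
    unfold Good
    rw [D_inn hB', R_inn hB']
    exact hG B (hB'.trans hA) ⟨x, hx, fun h => hyA (h ▸ hB' hx)⟩
      ⟨z, hA hzW, hzB, fun h => hyA (h ▸ hzW)⟩

lemma P_contract2 {k : ℤ} (hk : 0 < k) {G : MI V E} {y : V} {m : ℤ} (hT : ThyP k G y m)
    (IH : ∀ H : MI V E, H.W.card < G.W.card → ThyT k H → Sol k H)
    (IHP : ∀ H : MI V E, H.W.card < G.W.card → ∀ y m, ThyP k H y m → Sol k H)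
    {A : Finset V} (hA : A ⊆ G.W) (hyA : y ∈ A) (hx : ∃ x ∈ A, x ≠ y)
    (hz : ∃ z ∈ G.W, z ∉ A ∧ z ≠ y)
    (ht : ¬ Loose k G A) : Sol k G := by
  obtain ⟨hV, hyW, hne, hD, hR, hiy, hoy, hG⟩ := hT
  obtain ⟨x0, hx0, hx0y⟩ := hx
  obtain ⟨z0, hz0, hz0A, hz0y⟩ := hz
  have h2 : 2 ≤ A.card := Finset.one_lt_card.mpr ⟨x0, hx0, y, hyA, hx0y⟩
  obtain ⟨h, hsol⟩ := IH (G.con A y) (card_con hA hyA h2) ⟨valid_con hV hA hyA, ⟨y, by simp [con]⟩, by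
    rintro B hB ⟨x, hx⟩ ⟨z, hzW, hzB⟩
    unfold Good
    rw [D_con hB hyA, R_con hB hyA]
    refine hG _ (pre_sub hA hyA hB) ?_ ?_
    · by_cases hxy : x = y
      · subst hxy; exact ⟨x0, by simp [pre, hx, hx0], hx0y⟩
      · exact ⟨x, sub_pre hx, hxy⟩
    · by_cases hzy : z = y
      · subst hzy
        refine ⟨x0, hA hx0, ?_, hx0y⟩
        rw [← phi_mem hB hyA]; simp [phi, hx0, hzB]
      · exact ⟨z, con_W_sub hA hyA hzW, notMem_pre hB hyA hzW hzB, hzy⟩⟩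
  have hvi := valid_inn hk hV hyA hsol ht
  have hDi := D_inn (G := G) (a := y) (h := h) (Finset.singleton_subset_iff.mpr hyA)
  have hRi := R_inn (G := G) (a := y) (h := h) (Finset.singleton_subset_iff.mpr hyA)
  have hey : m ≤ ∑ e ∈ G.F, (if G.s e ∈ A ∧ G.t e ∈ A then cr {y} (G.s e) (G.t e) else 0) := by
    by_contra hlt
    push Not at hlt
    apply ht
    have hA0 := hG (A.erase y) ((Finset.erase_subset _ _).trans hA)
      ⟨x0, by simp [hx0, hx0y], hx0y⟩ ⟨z0, hz0, by simp [hz0A], hz0y⟩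
    have e1 := insY_D G (A := A.erase y) (y := y) (by simp)
    have e2 := insY_R G (A := A.erase y) (y := y) (by simp)
    rw [Finset.insert_erase hyA] at e1 e2
    unfold Loose
    obtain ⟨I, hI, hl, hu⟩ := hA0
    refine ⟨I + (m - ∑ e ∈ G.F, (if G.s e ∈ A ∧ G.t e ∈ A then cr {y} (G.s e) (G.t e) else 0)), ?_,
      by linarith, by linarith⟩
    rw [e2]
    refine dvdc (dvd_add hI hR) ?_
    ring
  have hsum : (G.inn A y h).i y + (G.inn A y h).o y ≤ m := by
    have e3 : (G.inn A y h).D {y} = ∑ e ∈ G.F, (if G.s e ∈ A ∧ G.t e ∈ A then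
        cr {y} (G.s e) (G.t e) else 0) + ((G.inn A y h).i y + (G.inn A y h).o y) := by
      unfold D; rw [Finset.sum_singleton]
      congr 1
      simp only [inn]; rw [Finset.sum_filter]
    linarith
  have hi0 := hvi.hi y
  have ho0 := hvi.ho y
  refine combine hyA hsol (IHP _ ?_ y m ⟨hvi, hyA, ⟨x0, hx0, hx0y⟩, by rw [hDi, hD],
    by rw [hRi]; exact hR, by linarith, by linarith, ?_⟩)
  · exact Finset.card_lt_card ⟨hA, fun h => hz0A (h hz0)⟩
  · rintro B hB hx ⟨z, hzW, hzB, hzy⟩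
    have hB' : B ⊆ A := hB
    unfold Good
    rw [D_inn hB', R_inn hB']
    exact hG B (hB'.trans hA) hx ⟨z, hA hzW, hzB, hzy⟩

/-- drop an isolated vertex -/
lemma P_zero {k : ℤ} {G : MI V E} {y : V} (hT : ThyP k G y 0)
    (IH : ∀ H : MI V E, H.W.card < G.W.card → ThyT k H → Sol k H) : Sol k G := by
  obtain ⟨hV, hyW, ⟨x0, hx0, hx0y⟩, hD, hR, hiy, hoy, hG⟩ := hT
  have hi0 := hV.hi y
  have ho0 := hV.ho y
  have hcr : ∀ e ∈ G.F, cr {y} (G.s e) (G.t e) = 0 := by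
    have h1 : ∑ e ∈ G.F, cr {y} (G.s e) (G.t e) = 0 := by
      have h2 : 0 ≤ ∑ e ∈ G.F, cr {y} (G.s e) (G.t e) :=
        Finset.sum_nonneg (fun e _ => by unfold cr; split_ifs <;> norm_num)
      unfold D at hD; rw [Finset.sum_singleton] at hD; linarith
    exact (Finset.sum_eq_zero_iff_of_nonneg (fun e _ => by unfold cr; split_ifs <;> norm_num)).mp h1
  have hst : ∀ e ∈ G.F, (G.s e = y ↔ G.t e = y) := by
    intro e he
    have := hcr e he
    simpa [cr] using this
  have hi : G.i y = 0 := by linarith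
  have ho : G.o y = 0 := by linarith
  let H : MI V E := { G with W := G.W.erase y, F := G.F.filter (fun e => G.s e ≠ y) }
  have hHV : Valid k H := by
    have hW : ∀ f : V → ℤ, ∑ v ∈ G.W.erase y, f v = ∑ v ∈ G.W, f v - f y := by
      intro f; rw [← Finset.add_sum_erase _ _ hyW]; ring
    refine ⟨?_, ?_, hV.hi, hV.ho, ?_, ?_⟩
    · intro e he; simp [H] at he ⊢; exact ⟨he.2, hV.hs e he.1⟩
    · intro e he; simp [H] at he ⊢
      exact ⟨fun h => he.2 ((hst e he.1).mpr h), hV.ht e he.1⟩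
    · simp only [H]
      rw [hW, hW, hi]
      refine dvdc (dvd_add hV.sum hR) ?_
      have : (G.F.card : ℤ) = (G.F.filter (fun e => G.s e ≠ y)).card +
          ∑ e ∈ G.F, ins {y} (G.s e) (G.t e) := by
        rw [Finset.card_filter, Finset.card_eq_sum_ones]; push_cast
        rw [← Finset.sum_add_distrib]
        refine Finset.sum_congr rfl (fun e he => ?_)
        have := hst e he
        by_cases h : G.s e = y
        · simp [ins, h, this.mp h]
        · simp [ins, h]
      unfold R; rw [Finset.sum_singleton, this]; ring
    · simp only [H]; rw [hW, hW, hi, ho]; simpa using hV.two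
  have hHD : ∀ A, y ∉ A → H.D A = G.D A := by
    intro A hA
    unfold D; congr 1
    simp only [H]; rw [Finset.sum_filter]
    refine Finset.sum_congr rfl (fun e he => ?_)
    have := hst e he
    by_cases h : G.s e = y
    · simp [cr, h, this.mp h]
    · simp [h]
  have hHR : ∀ A, y ∉ A → H.R A = G.R A := by
    intro A hA
    unfold R; congr 1
    simp only [H]; rw [Finset.sum_filter]
    refine Finset.sum_congr rfl (fun e he => ?_)
    by_cases h : G.s e = y
    · simp [ins, h, hA]
    · simp [h]
  obtain ⟨h, hs1, hs2⟩ := IH H (Finset.card_erase_lt_of_mem hyW) ⟨hHV, ⟨x0, by simp [H, hx0, hx0y]⟩, by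
    rintro A hA ⟨x, hx⟩ ⟨z, hz, hzA⟩
    have hyA : y ∉ A := fun h => by have := hA h; simp [H] at this
    unfold Good; rw [hHD A hyA, hHR A hyA]
    refine hG A (hA.trans (Finset.erase_subset _ _)) ⟨x, hx, fun h => hyA (h ▸ hx)⟩ ⟨z, ?_⟩
    simp [H] at hz; exact ⟨hz.2, hzA, hz.1⟩⟩
  have hs1' : ∀ e ∈ G.F, G.s e ≠ y → h e = G.s e ∨ h e = G.t e := fun e he hy =>
    hs1 e (by simp [H, he, hy])
  refine ⟨fun e => if G.s e = y then y else h e, fun e he => ?_, fun v hv => ?_⟩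
  · by_cases h : G.s e = y
    · simp [h]
    · simpa [h] using hs1' e he h
  · by_cases hvy : v = y
    · subst hvy
      refine dvdc (dvd_neg.mpr hR) ?_
      unfold R; rw [Finset.sum_singleton, hi]
      have : ∑ e ∈ G.F, (if (if G.s e = v then v else h e) = v then (1:ℤ) else 0) =
          ∑ e ∈ G.F, ins {v} (G.s e) (G.t e) := by
        refine Finset.sum_congr rfl (fun e he => ?_)
        have h1 := hst e he
        have h2 := hs1' e he
        by_cases h : G.s e = v
        · simp [ins, h, h1.mp h]
        · have : G.t e ≠ v := fun hh => h (h1.mpr hh)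
          simp [ins, h, this]; grind
      rw [this]; ring
    · have := hs2 v (by simp [H, hv, hvy])
      simp only [H] at this
      rw [Finset.sum_filter] at this
      convert this using 2
      refine Finset.sum_congr rfl (fun e he => ?_)
      by_cases h : G.s e = y
      · simp [h, Ne.symm hvy]
      · simp [h]

end MI

set_option linter.unusedSectionVars false
namespace MI
variable {V E : Type} [DecidableEq V] [DecidableEq E]

lemma valid_opDel {k : ℤ} {G : MI V E} (h : Valid k G) {e : E} {y : V} (hy : y ∈ G.W) :
    Valid k (G.opDel e y) := by
  refine ⟨fun e' he' => ?_, fun e' he' => ?_, h.hi, h.ho, h.sum, h.two⟩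
  · by_cases hee : e' = e
    · subst hee; simpa [opDel] using hy
    · simpa [opDel, Function.update_of_ne hee] using h.hs e' he'
  · by_cases hee : e' = e
    · subst hee; simpa [opDel] using hy
    · simpa [opDel, Function.update_of_ne hee] using h.ht e' he'

lemma valid_opLift {k : ℤ} {G : MI V E} (h : Valid k G) {e₁ e₂ : E} {y x₁ x₂ : V} (hy : y ∈ G.W)
    (h1 : x₁ ∈ G.W) (h2 : x₂ ∈ G.W) : Valid k (G.opLift e₁ e₂ y x₁ x₂) := by
  refine ⟨fun e' he' => ?_, fun e' he' => ?_, h.hi, h.ho, h.sum, h.two⟩ <;>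
  · by_cases hee : e' = e₂
    · subst hee; simpa [opLift] using hy
    · by_cases hee1 : e' = e₁
      · subst hee1; simpa [opLift, Function.update_of_ne hee]
      · simp only [opLift, Function.update_of_ne hee, Function.update_of_ne hee1]
        first | exact h.hs e' he' | exact h.ht e' he'

lemma valid_opIn {k : ℤ} {G : MI V E} (h : Valid k G) {v : V} {q : ℤ} (hv : v ∈ G.W)
    (hq : 0 ≤ G.i v + q)
    (two : (∑ v ∈ G.W, G.i v + q ≤ k - 1 ∧ ∑ v ∈ G.W, G.o v ≤ 2 * k - 1) ∨
        (∑ v ∈ G.W, G.i v + q ≤ 2 * k - 1 ∧ ∑ v ∈ G.W, G.o v ≤ k - 1)) :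
    Valid k (G.opIn v q) := by
  refine ⟨h.hs, h.ht, fun u => ?_, h.ho, ?_, ?_⟩
  · by_cases huv : u = v
    · subst huv; simpa [opIn] using hq
    · simpa [opIn, Function.update_of_ne huv] using h.hi u
  · simp only [opIn, sum_upd, if_pos hv]
    exact dvdc h.sum (by ring)
  · simpa only [opIn, sum_upd, if_pos hv] using two
lemma valid_opOut {k : ℤ} {G : MI V E} (h : Valid k G) {v : V} {q : ℤ} (hv : v ∈ G.W)
    (hq : 0 ≤ G.o v + q)
    (two : (∑ v ∈ G.W, G.i v ≤ k - 1 ∧ ∑ v ∈ G.W, G.o v + q ≤ 2 * k - 1) ∨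
        (∑ v ∈ G.W, G.i v ≤ 2 * k - 1 ∧ ∑ v ∈ G.W, G.o v + q ≤ k - 1)) :
    Valid k (G.opOut v q) := by
  refine ⟨h.hs, h.ht, h.hi, fun u => ?_, h.sum, ?_⟩
  · by_cases huv : u = v
    · subst huv; simpa [opOut] using hq
    · simpa [opOut, Function.update_of_ne huv] using h.ho u
  · simpa only [opOut, sum_upd, if_pos hv] using two

lemma sum_i_opIn (G : MI V E) {v : V} {q : ℤ} (hv : v ∈ G.W) :
    ∑ u ∈ G.W, (G.opIn v q).i u = ∑ u ∈ G.W, G.i u + q := by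
  simp only [opIn, sum_upd, if_pos hv]
lemma sum_o_opOut (G : MI V E) {v : V} {q : ℤ} (hv : v ∈ G.W) :
    ∑ u ∈ G.W, (G.opOut v q).o u = ∑ u ∈ G.W, G.o u + q := by
  simp only [opOut, sum_upd, if_pos hv]

lemma cr_nonneg (A : Finset V) (x y : V) : 0 ≤ cr A x y := by unfold cr; split_ifs <;> norm_num

lemma exists_cross {G : MI V E} {A : Finset V} (h : 0 < ∑ e ∈ G.F, cr A (G.s e) (G.t e)) :
    ∃ e ∈ G.F, ∃ x y, G.Jn e x y ∧ x ∉ A ∧ y ∈ A := by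
  obtain ⟨e, he, hc⟩ := Finset.exists_ne_zero_of_sum_ne_zero h.ne'
  refine ⟨e, he, ?_⟩
  by_cases h1 : G.s e ∈ A
  · refine ⟨G.t e, G.s e, Or.inr ⟨rfl, rfl⟩, ?_, h1⟩
    intro h2; simp [cr, h1, h2] at hc
  · refine ⟨G.s e, G.t e, Or.inl ⟨rfl, rfl⟩, h1, ?_⟩
    by_contra h2; simp [cr, h1, h2] at hc

lemma jn_mem {k : ℤ} {G : MI V E} (hV : Valid k G) {e : E} (he : e ∈ G.F) {x y : V}
    (h : G.Jn e x y) : x ∈ G.W ∧ y ∈ G.W := by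
  rcases h with ⟨rfl, rfl⟩ | ⟨rfl, rfl⟩
  · exact ⟨hV.hs e he, hV.ht e he⟩
  · exact ⟨hV.ht e he, hV.hs e he⟩
lemma Jn.symm {G : MI V E} {e : E} {x y : V} (h : G.Jn e x y) : G.Jn e y x := by
  rcases h with h | h
  · exact Or.inr h
  · exact Or.inl h

theorem P_thm {k : ℤ} (hk : 1 ≤ k) (n : ℕ)
    (IH : ∀ H : MI V E, H.W.card < n → ThyT k H → Sol k H)
    (IHP : ∀ H : MI V E, H.W.card < n → ∀ y m, ThyP k H y m → Sol k H) :
    ∀ (m : ℕ) (G : MI V E), G.W.card = n → ∀ y, ThyP k G y m → Sol k G := by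
  intro m
  induction m with
  | zero =>
    intro G hn y hT
    subst hn
    exact P_zero (by simpa using hT) IH
  | succ m ihm =>
    intro G hn y hT
    by_cases hLL : ∃ A ⊆ G.W, (∃ x ∈ A, x ≠ y) ∧ (∃ z ∈ G.W, z ∉ A ∧ z ≠ y) ∧ 2 ≤ A.card ∧
        ¬ Loose k G A
    · obtain ⟨A, hA, hx, hz, h2, ht⟩ := hLL
      by_cases hyA : y ∈ A
      · exact P_contract2 (by linarith) hT (by rwa [hn]) (by rwa [hn]) hA hyA hx hz ht
      · exact P_contract1 (by linarith) hT (by rwa [hn]) (by rwa [hn]) hA h2 hyA hz ht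
    have hL : ∀ A ⊆ G.W, (∃ x ∈ A, x ≠ y) → (∃ z ∈ G.W, z ∉ A ∧ z ≠ y) → 2 ≤ A.card →
        Loose k G A := by
      intro A h1 h2 h3 h4
      by_contra h5
      exact hLL ⟨A, h1, h2, h3, h4, h5⟩
    clear hLL
    obtain ⟨hV, hyW, hxx, hD, hR, hiy, hoy, hG⟩ := hT
    have hLy : ∀ A ⊆ G.W, (∃ x ∈ A, x ≠ y) → (∃ z ∈ G.W, z ∉ A ∧ z ≠ y) → y ∈ A → Loose k G A := by
      rintro A h1 ⟨x, hx, hxy⟩ h3 h4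
      exact hL A h1 ⟨x, hx, hxy⟩ h3 (Finset.one_lt_card.mpr ⟨x, hx, y, h4, hxy⟩)
    have hi0 := hV.hi y
    have ho0 := hV.ho y
    have htwo := hV.two
    push_cast at hD hR hiy hoy
    have hDy : ∑ e ∈ G.F, cr {y} (G.s e) (G.t e) + (G.i y + G.o y) = 2 * (m + 1) := by
      unfold D at hD; rwa [Finset.sum_singleton] at hD
    rcases hi0.eq_or_lt with hi | hi <;> rcases ho0.eq_or_lt with ho | ho
    · -- lifting
      let N := G.F.filter (fun e => cr {y} (G.s e) (G.t e) ≠ 0)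
      have hN : (N.card : ℤ) = 2 * (m + 1) := by
        simp only [N, Finset.card_filter]; push_cast
        rw [← hDy, ← hi, ← ho, add_zero, add_zero]
        refine Finset.sum_congr rfl (fun e _ => ?_)
        unfold cr; split_ifs <;> simp_all
      have hNJ : ∀ e ∈ N, e ∈ G.F ∧ G.Jn e (G.ot {y} e) y ∧ G.ot {y} e ≠ y := by
        intro e he
        simp only [N, Finset.mem_filter, cr, Finset.mem_singleton] at he
        refine ⟨he.1, ?_⟩
        unfold Jn ot
        simp only [Finset.mem_singleton]
        by_cases h1 : G.s e = y <;> by_cases h2 : G.t e = y <;> simp_all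
      -- choice of the two edges
      have key : ∃ e₁ e₂ x₁ x₂, e₁ ∈ G.F ∧ e₂ ∈ G.F ∧ e₁ ≠ e₂ ∧ G.Jn e₁ x₁ y ∧ G.Jn e₂ x₂ y ∧
          x₁ ≠ y ∧ x₂ ≠ y ∧ ∀ A ⊆ G.W, (∃ z ∈ G.W, z ∉ A ∧ z ≠ y) → y ∉ A →
            x₁ ∈ A → x₂ ∈ A → Loose k G A := by
        by_cases hdiff : ∃ e₁ ∈ N, ∃ e₂ ∈ N, G.ot {y} e₁ ≠ G.ot {y} e₂
        · obtain ⟨e₁, h1, e₂, h2, hd⟩ := hdiff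
          refine ⟨e₁, e₂, _, _, (hNJ _ h1).1, (hNJ _ h2).1, fun h => hd (by rw [h]), (hNJ _ h1).2.1,
            (hNJ _ h2).2.1, (hNJ _ h1).2.2, (hNJ _ h2).2.2, ?_⟩
          intro A hA hz hyA hx1 hx2
          exact hL A hA ⟨_, hx1, (hNJ _ h1).2.2⟩ hz (Finset.one_lt_card.mpr ⟨_, hx1, _, hx2, hd⟩)
        · push Not at hdiff
          obtain ⟨e₁, h1, e₂, h2, hd⟩ := Finset.one_lt_card.mp (by omega : 1 < N.card)
          refine ⟨e₁, e₂, _, _, (hNJ _ h1).1, (hNJ _ h2).1, hd, (hNJ _ h1).2.1,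
            (hNJ _ h2).2.1, (hNJ _ h1).2.2, (hNJ _ h2).2.2, ?_⟩
          intro A hA hz hyA hx1 hx2
          by_cases hc : 2 ≤ A.card
          · exact hL A hA ⟨_, hx1, (hNJ _ h1).2.2⟩ hz hc
          have hA1 : A = {G.ot {y} e₁} := by
            have : A.card ≤ 1 := by omega
            rw [Finset.card_le_one] at this
            ext u; simp only [Finset.mem_singleton]
            exact ⟨fun hu => this _ hu _ hx1, fun hu => hu ▸ hx1⟩
          obtain ⟨z, hzW, hzA, hzy⟩ := hz
          obtain ⟨I, hI, hl, hu⟩ := hG (insert y A) (Finset.insert_subset hyW hA)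
            ⟨_, Finset.mem_insert_of_mem hx1, (hNJ _ h1).2.2⟩ ⟨z, hzW, by simp [hzA, hzy], hzy⟩
          have hey : ∑ e ∈ G.F, (if G.s e ∈ insert y A ∧ G.t e ∈ insert y A then
              cr {y} (G.s e) (G.t e) else 0) = 2 * (m + 1) := by
            rw [← hDy, ← hi, ← ho, add_zero, add_zero]
            refine Finset.sum_congr rfl (fun e he => ?_)
            by_cases hc0 : cr {y} (G.s e) (G.t e) = 0
            · simp [hc0]
            · have heN : e ∈ N := by simp [N, he, hc0]
              have h3 := (hNJ e heN).2.1
              rw [← hdiff e₁ h1 e heN] at h3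
              rw [if_pos]
              rcases h3 with ⟨h4, h5⟩ | ⟨h4, h5⟩ <;> rw [h4, h5] <;> simp [hx1]
          rw [insY_R G hyA, hey] at hI
          rw [insY_D G hyA, hey] at hu
          refine ⟨I + (m + 1), ?_, by linarith [(Int.natCast_nonneg m : (0:ℤ) ≤ m)],
            by linarith [(Int.natCast_nonneg m : (0:ℤ) ≤ m)]⟩
          refine dvdc (dvd_sub hI hR) ?_
          ring
      obtain ⟨e₁, e₂, x₁, x₂, he₁, he₂, hne, hj₁, hj₂, hx₁, hx₂, hLx⟩ := key
      apply sol_opLift he₁ he₂ hne hj₁ hj₂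
      refine ihm _ hn y ⟨valid_opLift hV hyW (jn_mem hV he₁ hj₁).1 (jn_mem hV he₂ hj₂).1, hyW, hxx,
        ?_, ?_, ?_, ?_, ?_⟩
      · rw [D_opLift he₁ he₂ hne hj₁ hj₂, hD]; simp [cr, hx₁, hx₂]; ring
      · rw [R_opLift he₁ he₂ hne hj₁ hj₂]
        refine dvdc hR ?_
        simp [ins, hx₁, hx₂]; ring
      · change G.i y ≤ m; linarith [(Int.natCast_nonneg m : (0:ℤ) ≤ m)]
      · change G.o y ≤ m; linarith [(Int.natCast_nonneg m : (0:ℤ) ≤ m)]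
      · intro A hA hx hz
        have h1 := hG A hA hx hz
        have h2 := hLy A hA hx hz
        have h3 := hLx A hA hz
        unfold Good at h1 ⊢
        unfold Loose at h2 h3
        rw [D_opLift he₁ he₂ hne hj₁ hj₂, R_opLift he₁ he₂ hne hj₁ hj₂]
        by_cases ay : y ∈ A <;> by_cases a1 : x₁ ∈ A <;> by_cases a2 : x₂ ∈ A <;>
          simp only [ay, a1, a2, cr, ins, true_implies, not_true, not_false_eq_true] at h2 h3 ⊢ <;>
          first
          | (refine gd_mono 0 0 h1 ?_ ?_ ?_ ?_ <;> norm_num <;> ring1)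
          | (refine gd_mono 1 1 h2 ?_ ?_ ?_ ?_ <;> norm_num <;> ring1)
          | (refine gd_mono 1 1 h3 ?_ ?_ ?_ ?_ <;> norm_num <;> ring1)
    · -- o y > 0, i y = 0
      obtain ⟨e, he, x, y', hj, hx, hy'⟩ := exists_cross (G := G) (A := {y}) (by linarith)
      simp only [Finset.mem_singleton] at hx hy'
      subst hy'
      have hxW := (jn_mem hV he hj).1
      apply sol_opDel hj
      apply sol_opOut (v := y') (q := -1)
      apply sol_opOut (v := x) (q := 1)
      have hv1 : Valid k (G.opDel e y') := valid_opDel hV hyW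
      have hv2 : Valid k ((G.opDel e y').opOut y' (-1)) := valid_opOut hv1 hyW
        (by change 0 ≤ G.o y' + -1; linarith) (by
          rcases htwo with h | h
          · exact Or.inl ⟨h.1, by change ∑ v ∈ G.W, G.o v + -1 ≤ _; linarith [h.2]⟩
          · exact Or.inr ⟨h.1, by change ∑ v ∈ G.W, G.o v + -1 ≤ _; linarith [h.2]⟩)
      refine ihm _ hn y' ⟨valid_opOut hv2 hxW (by have := hv2.ho x; linarith) ?_, hyW, hxx,
        ?_, ?_, ?_, ?_, ?_⟩
      · change (∑ v ∈ (G.opDel e y').W, G.i v ≤ _ ∧ ∑ v ∈ (G.opDel e y').W, ((G.opDel e y').opOut y' (-1)).o v + 1 ≤ _) ∨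
          (∑ v ∈ (G.opDel e y').W, G.i v ≤ _ ∧ ∑ v ∈ (G.opDel e y').W, ((G.opDel e y').opOut y' (-1)).o v + 1 ≤ _)
        rw [sum_o_opOut (G.opDel e y') hyW, neg_add_cancel_right]
        exact htwo
      · rw [D_opOut, D_opOut, D_opDel he hj, hD]; simp [cr, hx]; ring
      · rw [R_opOut, R_opOut, R_opDel he hj]
        refine dvdc hR ?_
        simp [ins, hx]; ring
      · change G.i y' ≤ m; linarith [(Int.natCast_nonneg m : (0:ℤ) ≤ m)]
      · simp only [opOut, opDel, Function.update_of_ne (Ne.symm hx), Function.update_self]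
        linarith
      · intro A hA hx hz
        have h1 := hG A hA hx hz
        have h2 := hLy A hA hx hz
        unfold Good at h1 ⊢
        unfold Loose at h2
        rw [D_opOut, D_opOut, D_opDel he hj, R_opOut, R_opOut, R_opDel he hj]
        by_cases ay : y' ∈ A <;> by_cases a1 : x ∈ A <;>
          simp only [ay, a1, cr, ins, true_implies] at h2 ⊢ <;>
          first
          | (refine gd_mono 0 0 h1 ?_ ?_ ?_ ?_ <;> norm_num <;> ring1)
          | (refine gd_mono 1 1 h2 ?_ ?_ ?_ ?_ <;> norm_num <;> ring1)
    · obtain ⟨e, he, x, y', hj, hx, hy'⟩ := exists_cross (G := G) (A := {y}) (by linarith)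
      simp only [Finset.mem_singleton] at hx hy'
      subst hy'
      have hxW := (jn_mem hV he hj).1
      have hj' := hj.symm
      apply sol_opDel hj'
      apply sol_opIn (v := y') (q := -1)
      apply sol_opIn (v := x) (q := 1)
      have hv1 : Valid k (G.opDel e x) := valid_opDel hV hxW
      have hv2 : Valid k ((G.opDel e x).opIn y' (-1)) := valid_opIn hv1 hyW
        (by change 0 ≤ G.i y' + -1; linarith) (by
          rcases htwo with h | h
          · exact Or.inl ⟨by change ∑ v ∈ G.W, G.i v + -1 ≤ _; linarith [h.1], h.2⟩
          · exact Or.inr ⟨by change ∑ v ∈ G.W, G.i v + -1 ≤ _; linarith [h.1], h.2⟩)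
      refine ihm _ hn y' ⟨valid_opIn hv2 hxW (by have := hv2.hi x; linarith) ?_, hyW, hxx,
        ?_, ?_, ?_, ?_, ?_⟩
      · change (∑ v ∈ (G.opDel e x).W, ((G.opDel e x).opIn y' (-1)).i v + 1 ≤ _ ∧ ∑ v ∈ (G.opDel e x).W, G.o v ≤ _) ∨
          (∑ v ∈ (G.opDel e x).W, ((G.opDel e x).opIn y' (-1)).i v + 1 ≤ _ ∧ ∑ v ∈ (G.opDel e x).W, G.o v ≤ _)
        rw [sum_i_opIn (G.opDel e x) hyW, neg_add_cancel_right]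
        exact htwo
      · rw [D_opIn, D_opIn, D_opDel he hj', hD]; simp [cr, hx]; ring
      · rw [R_opIn, R_opIn, R_opDel he hj']
        refine dvdc hR ?_
        simp [ins, hx]; try ring
      · simp only [opIn, opDel, Function.update_of_ne (Ne.symm hx), Function.update_self]
        linarith
      · change G.o y' ≤ m; linarith [(Int.natCast_nonneg m : (0:ℤ) ≤ m)]
      · intro A hA hx hz
        have h1 := hG A hA hx hz
        have h2 := hLy A hA hx hz
        unfold Good at h1 ⊢
        unfold Loose at h2
        rw [D_opIn, D_opIn, D_opDel he hj', R_opIn, R_opIn, R_opDel he hj']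
        by_cases ay : y' ∈ A <;> by_cases a1 : x ∈ A <;>
          simp only [ay, a1, cr, ins, true_implies] at h2 ⊢ <;>
          first
          | (refine gd_mono 0 0 h1 ?_ ?_ ?_ ?_ <;> norm_num <;> ring1)
          | (refine gd_mono 1 1 h2 ?_ ?_ ?_ ?_ <;> norm_num <;> ring1)
    · apply sol_opIn (v := y) (q := -1)
      apply sol_opOut (v := y) (q := -1)
      have hv1 : Valid k (G.opIn y (-1)) := valid_opIn hV hyW (by linarith) (by
          rcases htwo with h | h
          · exact Or.inl ⟨by linarith [h.1], h.2⟩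
          · exact Or.inr ⟨by linarith [h.1], h.2⟩)
      refine ihm _ hn y ⟨valid_opOut hv1 hyW (by change 0 ≤ G.o y + -1; linarith) ?_, hyW, hxx,
        ?_, ?_, ?_, ?_, ?_⟩
      · have := hv1.two
        rcases this with h | h
        · exact Or.inl ⟨h.1, by linarith [h.2]⟩
        · exact Or.inr ⟨h.1, by linarith [h.2]⟩
      · rw [D_opOut, D_opIn, hD]; simp; ring
      · rw [R_opOut, R_opIn]
        refine dvdc hR ?_
        simp; try ring
      · simp only [opOut, opIn, Function.update_self]; linarith
      · simp only [opOut, opIn, Function.update_self]; linarith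
      · intro A hA hx hz
        have h1 := hG A hA hx hz
        have h2 := hLy A hA hx hz
        unfold Good at h1 ⊢
        unfold Loose at h2
        rw [D_opOut, D_opIn, R_opOut, R_opIn]
        by_cases ay : y ∈ A <;> simp only [ay, true_implies] at h2 ⊢ <;>
          first
          | (refine gd_mono 0 0 h1 ?_ ?_ ?_ ?_ <;> norm_num <;> ring1)
          | (refine gd_mono 1 1 h2 ?_ ?_ ?_ ?_ <;> norm_num <;> ring1)

end MI

set_option linter.unusedSectionVars false
namespace MI
variable {V E : Type} [DecidableEq V] [DecidableEq E]

def mu (k : ℤ) (G : MI V E) : ℤ :=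
  ∑ e ∈ G.F, (if G.s e = G.t e then 0 else 3 * k) + ∑ v ∈ G.W, (G.i v + G.o v)

lemma mu_opDel {k : ℤ} {G : MI V E} {e : E} {x y : V} (he : e ∈ G.F) (h : G.Jn e x y) (hxy : x ≠ y) :
    mu k (G.opDel e y) = mu k G - 3 * k := by
  simp only [mu, opDel]
  rw [sum_chg he (g := fun e => if G.s e = G.t e then 0 else 3 * k)]
  · have : G.s e ≠ G.t e := by
      rcases h with ⟨h1, h2⟩ | ⟨h1, h2⟩ <;> rw [h1, h2]
      · exact hxy
      · exact hxy.symm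
    simp [this]; ring
  · intro e' h'; simp [Function.update_of_ne h']
lemma mu_opIn {k : ℤ} {G : MI V E} {v : V} {q : ℤ} (hv : v ∈ G.W) :
    mu k (G.opIn v q) = mu k G + q := by
  simp only [mu, opIn, Finset.sum_add_distrib, sum_upd, if_pos hv]; ring_nf
lemma mu_opOut {k : ℤ} {G : MI V E} {v : V} {q : ℤ} (hv : v ∈ G.W) :
    mu k (G.opOut v q) = mu k G + q := by
  simp only [mu, opOut, Finset.sum_add_distrib, sum_upd, if_pos hv]; ring_nf

lemma compl_D {k : ℤ} {G : MI V E} (hV : Valid k G) {A : Finset V} (hA : A ⊆ G.W) :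
    G.D A + G.D (G.W \ A) = 2 * ∑ e ∈ G.F, cr A (G.s e) (G.t e) +
      (∑ v ∈ G.W, G.i v + ∑ v ∈ G.W, G.o v) := by
  have h1 : ∑ e ∈ G.F, cr (G.W \ A) (G.s e) (G.t e) = ∑ e ∈ G.F, cr A (G.s e) (G.t e) := by
    refine Finset.sum_congr rfl (fun e he => ?_)
    have := hV.hs e he
    have := hV.ht e he
    unfold cr; simp [*, not_iff_not]
  unfold D
  rw [h1, ← Finset.sum_add_distrib, ← Finset.sum_sdiff hA]; ring
lemma compl_R {k : ℤ} {G : MI V E} (hV : Valid k G) {A : Finset V} (hA : A ⊆ G.W) :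
    G.R A + G.R (G.W \ A) = ∑ v ∈ G.W, G.P v - G.F.card + ∑ e ∈ G.F, cr A (G.s e) (G.t e) := by
  have h1 : ∑ e ∈ G.F, ins A (G.s e) (G.t e) + ∑ e ∈ G.F, ins (G.W \ A) (G.s e) (G.t e)
      + ∑ e ∈ G.F, cr A (G.s e) (G.t e) = G.F.card := by
    rw [← Finset.sum_add_distrib, ← Finset.sum_add_distrib, Finset.card_eq_sum_ones]
    push_cast
    refine Finset.sum_congr rfl (fun e he => ?_)
    have := hV.hs e he
    have := hV.ht e he
    unfold cr ins
    by_cases h1 : G.s e ∈ A <;> by_cases h2 : G.t e ∈ A <;> simp [*]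
  unfold R
  rw [← Finset.sum_sdiff hA, ← h1]; ring

lemma gd_D {k c₁ c₂ R D : ℤ} (h : gd k c₁ c₂ R D) : c₁ + c₂ ≤ D := by
  obtain ⟨I, _, h1, h2⟩ := h; linarith

lemma T_cut {k : ℤ} (hk : 3 ≤ k) {G : MI V E} (hT : ThyT k G) {A : Finset V} (hA : A ⊆ G.W)
    (hn : A.Nonempty) (hz : ∃ z ∈ G.W, z ∉ A) : 0 < ∑ e ∈ G.F, cr A (G.s e) (G.t e) := by
  obtain ⟨hV, _, hG⟩ := hT
  have h1 := gd_D (hG A hA hn hz)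
  obtain ⟨z, hz1, hz2⟩ := hz
  obtain ⟨x, hx⟩ := hn
  have h2 := gd_D (hG (G.W \ A) Finset.sdiff_subset ⟨z, by simp [hz1, hz2]⟩ ⟨x, hA hx, by simp [hx]⟩)
  have h3 := compl_D hV hA
  rcases hV.two with h | h <;> linarith [h.1, h.2]

/-- bound on constants at a vertex of degree 2k-2 -/
lemma T_bound {k : ℤ} (hk : 3 ≤ k) {G : MI V E} (hT : ThyT k G) {v : V} (hv : v ∈ G.W)
    (hz : ∃ z ∈ G.W, z ≠ v) (hD : G.D {v} = 2 * (k - 1)) (hR : k ∣ k - 1 - G.R {v}) :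
    G.i v ≤ k - 1 ∧ G.o v ≤ k - 1 := by
  obtain ⟨hV, _, hG⟩ := hT
  obtain ⟨z, hzW, hzv⟩ := hz
  have hA : {v} ⊆ G.W := by simpa using hv
  obtain ⟨I, hI, hl, hu⟩ := hG (G.W \ {v}) Finset.sdiff_subset ⟨z, by simp [hzW, hzv]⟩
    ⟨v, hv, by simp⟩
  have e1 := compl_D hV hA
  have e2 := compl_R hV hA
  have hi := Finset.single_le_sum (f := G.i) (fun x _ => hV.hi x) hv
  have ho := Finset.single_le_sum (f := G.o) (fun x _ => hV.ho x) hv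
  have hDv : ∑ e ∈ G.F, cr {v} (G.s e) (G.t e) + (G.i v + G.o v) = 2 * (k - 1) := by
    rw [← hD]; unfold D; rw [Finset.sum_singleton]
  have hi0 := hV.hi v
  have ho0 := hV.ho v
  have htwo := hV.two
  have hsum := hV.sum
  generalize ∑ e ∈ G.F, cr {v} (G.s e) (G.t e) = c at *
  generalize ∑ v ∈ G.W, G.i v = iW at *
  generalize ∑ v ∈ G.W, G.o v = oW at *
  have hj : k ∣ iW + c + 1 - I := by
    refine dvdc (dvd_sub (dvd_sub (dvd_sub (dvd_refl k) hI) hR) hsum) ?_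
    linarith
  obtain ⟨j, hj⟩ := hj
  by_contra hcon
  have hcon' : k ≤ G.i v ∨ k ≤ G.o v := by
    by_contra h; push Not at h; exact hcon ⟨by linarith [h.1], by linarith [h.2]⟩
  rcases hcon' with h | h
  · have htw : iW ≤ 2 * k - 1 ∧ oW ≤ k - 1 := by
      rcases htwo with h' | h'
      · linarith [h'.1]
      · exact h'
    have : 2 ≤ j := by
      by_contra hh; push Not at hh
      nlinarith [htw.1, htw.2]
    nlinarith [htw.1, htw.2]
  · have htw : iW ≤ k - 1 ∧ oW ≤ 2 * k - 1 := by
      rcases htwo with h' | h'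
      · exact h'
      · linarith [h'.2]
    have : j ≤ 0 := by
      by_contra hh; push Not at hh
      nlinarith [htw.1, htw.2]
    nlinarith [htw.1, htw.2]

theorem T_thm {k : ℤ} (hk : 3 ≤ k) (n : ℕ)
    (IH : ∀ H : MI V E, H.W.card < n → ThyT k H → Sol k H)
    (IHP : ∀ H : MI V E, H.W.card = n → ∀ y m, ThyP k H y m → Sol k H) :
    ∀ (N : ℕ) (G : MI V E), G.W.card = n → mu k G < N → ThyT k G → Sol k G := by
  intro N
  induction N with
  | zero =>
    intro G hn hmu hT
    exfalso
    have : 0 ≤ mu k G := by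
      unfold mu
      refine add_nonneg (Finset.sum_nonneg (fun e _ => by split_ifs <;> linarith))
        (Finset.sum_nonneg (fun v _ => add_nonneg (hT.1.hi v) (hT.1.ho v)))
    simp at hmu; linarith
  | succ N ihN =>
    intro G hn hmu hT
    push_cast at hmu
    by_cases hone : ¬ ∃ x ∈ G.W, ∃ z ∈ G.W, z ≠ x
    · push Not at hone
      obtain ⟨v, hv⟩ := hT.2.1
      have hW : G.W = {v} := by
        ext u; simp only [Finset.mem_singleton]
        exact ⟨fun hu => hone v hv u hu, fun h => h ▸ hv⟩
      refine ⟨G.s, fun e _ => Or.inl rfl, fun u hu => ?_⟩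
      have huv := hone v hv u hu
      subst huv
      have := hT.1.sum
      rw [hW, Finset.sum_singleton, Finset.sum_singleton] at this
      refine dvdc this ?_
      have h1 : ∑ e ∈ G.F, (if G.s e = u then (1:ℤ) else 0) = G.F.card := by
        rw [Finset.card_eq_sum_ones]; push_cast
        exact Finset.sum_congr rfl (fun e he => by rw [if_pos (hone u hv _ (hT.1.hs e he))])
      rw [h1]; ring
    push Not at hone
    have hother : ∀ v ∈ G.W, ∃ z ∈ G.W, z ≠ v := by
      obtain ⟨a, ha, b, hb, hab⟩ := hone
      intro v hv
      by_cases h : a = v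
      · exact ⟨b, hb, h ▸ hab⟩
      · exact ⟨a, ha, h⟩
    by_cases hLL : ∃ A ⊆ G.W, 2 ≤ A.card ∧ (∃ z ∈ G.W, z ∉ A) ∧ ¬ Loose k G A
    · obtain ⟨A, hA, h2, hz, ht⟩ := hLL
      exact T_contract (by linarith) hT (by rwa [hn]) hA h2 hz ht
    have hL : ∀ A ⊆ G.W, 2 ≤ A.card → (∃ z ∈ G.W, z ∉ A) → Loose k G A := by
      intro A h1 h2 h3
      by_contra h5
      exact hLL ⟨A, h1, h2, h3, h5⟩
    clear hLL
    have hcut := fun (A : Finset V) (hA : A ⊆ G.W) => T_cut (A := A) hk hT hA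
    have hbd := fun (v : V) (hv : v ∈ G.W) => T_bound hk hT hv (hother v hv)
    obtain ⟨hV, hne, hG⟩ := hT
    have hGv : ∀ v ∈ G.W, Good k G {v} := fun v hv => hG {v} (by simpa using hv) (by simp)
      (by obtain ⟨z, hz, hzv⟩ := hother v hv; exact ⟨z, hz, by simpa using hzv⟩)
    have hcutv : ∀ v ∈ G.W, ∃ e ∈ G.F, ∃ x, G.Jn e x v ∧ x ≠ v ∧ x ∈ G.W := by
      intro v hv
      obtain ⟨e, he, x, y, hj, hx, hy⟩ := exists_cross (hcut {v} (by simpa using hv) (by simp)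
        (by obtain ⟨z, hz, hzv⟩ := hother v hv; exact ⟨z, hz, by simpa using hzv⟩))
      simp only [Finset.mem_singleton] at hx hy
      subst hy
      exact ⟨e, he, x, hj, hx, (jn_mem hV he hj).1⟩
    by_cases hexc : ∃ v ∈ G.W, G.D {v} = 2 * (k - 1)
    · obtain ⟨v, hv, hD⟩ := hexc
      have hR : k ∣ k - 1 - G.R {v} := by
        obtain ⟨I, hI, hl, hu⟩ := hGv v hv
        have : I = k - 1 := by linarith
        rwa [this] at hI
      obtain ⟨h1, h2⟩ := hbd v hv hD hR
      exact IHP G hn v (k - 1) ⟨hV, hv, hother v hv, hD, hR, h1, h2,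
        fun A hA ⟨x, hx, _⟩ ⟨z, hz, hzA, _⟩ => hG A hA ⟨x, hx⟩ ⟨z, hz, hzA⟩⟩
    push Not at hexc
    -- sets that can absorb one more arc
    let cI : Finset V → Prop := fun A => gd k k (k-1) (G.R A) (G.D A)
    let cO : Finset V → Prop := fun A => gd k (k-1) k (G.R A) (G.D A)
    have hLI : ∀ A, Loose k G A → cI A := fun A h =>
      gd_mono 0 0 h (by ring) (by ring) (by linarith) (by linarith)
    have hLO : ∀ A, Loose k G A → cO A := fun A h =>
      gd_mono 0 0 h (by ring) (by ring) (by linarith) (by linarith)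
    have hbigI : ∀ A ⊆ G.W, (∃ z ∈ G.W, z ∉ A) → ∀ v ∈ A, cI {v} → cI A := by
      intro A hA hz v hv hc
      by_cases h2 : 2 ≤ A.card
      · exact hLI A (hL A hA h2 hz)
      · have : A = {v} := by
          have h3 : A.card ≤ 1 := by omega
          rw [Finset.card_le_one] at h3
          ext u; simp only [Finset.mem_singleton]
          exact ⟨fun hu => h3 _ hu _ hv, fun hu => hu ▸ hv⟩
        rw [this]; exact hc
    have hbigO : ∀ A ⊆ G.W, (∃ z ∈ G.W, z ∉ A) → ∀ v ∈ A, cO {v} → cO A := by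
      intro A hA hz v hv hc
      by_cases h2 : 2 ≤ A.card
      · exact hLO A (hL A hA h2 hz)
      · have : A = {v} := by
          have h3 : A.card ≤ 1 := by omega
          rw [Finset.card_le_one] at h3
          ext u; simp only [Finset.mem_singleton]
          exact ⟨fun hu => h3 _ hu _ hv, fun hu => hu ▸ hv⟩
        rw [this]; exact hc
    have hor : ∀ v ∈ G.W, cI {v} ∨ cO {v} := by
      intro v hv
      obtain ⟨I, hI, hl, hu⟩ := hGv v hv
      have := hexc v hv
      by_cases h1 : k ≤ I
      · exact Or.inl ⟨I, hI, h1, hu⟩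
      · refine Or.inr ⟨I, hI, hl, ?_⟩
        have : I = k - 1 := by omega
        omega
    by_cases hnoI : ∀ v ∈ G.W, ¬ cI {v}
    · have hO : ∀ v ∈ G.W, cO {v} := fun v hv => (hor v hv).resolve_left (hnoI v hv)
      by_cases hpos : ∃ v ∈ G.W, 0 < G.o v
      · obtain ⟨v, hv, hov⟩ := hpos
        apply sol_opOut (v := v) (q := -1)
        refine ihN _ hn ?_ ⟨valid_opOut hV hv (by linarith) ?_, hne, ?_⟩
        · rw [mu_opOut hv]; linarith
        · rcases hV.two with h | h
          · exact Or.inl ⟨h.1, by linarith [h.2]⟩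
          · exact Or.inr ⟨h.1, by linarith [h.2]⟩
        · intro A hA hAn hz
          unfold Good
          rw [D_opOut, R_opOut]
          by_cases hvA : v ∈ A
          · exact gd_mono 0 1 (hbigO A hA hz v hvA (hO v hv)) (by ring) (by simp [hvA]; ring)
              (by linarith) (by linarith)
          · exact gd_mono 0 0 (hG A hA hAn hz) (by ring) (by simp [hvA]) (by linarith) (by linarith)
      · push Not at hpos
        have ho0 : ∑ v ∈ G.W, G.o v = 0 :=
          Finset.sum_eq_zero (fun v hv => le_antisymm (hpos v hv) (hV.ho v))
        obtain ⟨v, hv⟩ := hne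
        obtain ⟨e, he, x, hj, hxv, hxW⟩ := hcutv v hv
        obtain ⟨I, hI, hl, hu⟩ := hGv v hv
        have hIk : I = k - 1 := by
          by_contra h
          exact hnoI v hv ⟨I, hI, by omega, hu⟩
        have hDlt : G.D {v} < 3 * k - 2 := by
          by_contra h
          exact hnoI v hv ⟨I + k, dvdc (dvd_add hI (dvd_refl k)) (by ring), by omega, by omega⟩
        have hDv := hexc v hv
        set q := 3 * k - 2 - G.D {v} with hq
        have hq1 : 1 ≤ q := by omega
        have hq2 : q ≤ k - 1 := by omega
        apply sol_opOut (v := v) (q := q)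
        have he' : e ∈ (G.opOut v q).F := he
        have hj' : (G.opOut v q).Jn e x v := hj
        apply sol_opDel hj'
        refine ihN _ hn ?_ ⟨valid_opDel (valid_opOut hV hv (by linarith [hV.ho v]) ?_) hv, ⟨v, hv⟩, ?_⟩
        · rw [mu_opDel he' hj' hxv, mu_opOut hv]; linarith
        · right; constructor
          · rcases hV.two with h | h <;> linarith [h.1]
          · linarith
        · intro A hA hAn hz
          unfold Good
          rw [D_opDel he' hj', R_opDel he' hj', D_opOut, R_opOut]
          by_cases hvA : v ∈ A <;> by_cases hxA : x ∈ A
          · exact gd_mono 0 (-q) (hG A hA hAn hz) (by simp [ins, hvA, hxA]) (by simp [cr, hvA, hxA])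
              (by linarith) (by linarith)
          · by_cases h2 : 2 ≤ A.card
            · exact gd_mono 1 (-q) (hL A hA h2 hz) (by simp [ins, hvA, hxA])
                (by simp [cr, hvA, hxA]; ring) (by linarith) (by linarith)
            · have hAv : A = {v} := by
                have h3 : A.card ≤ 1 := by omega
                rw [Finset.card_le_one] at h3
                ext u; simp only [Finset.mem_singleton]
                exact ⟨fun hu => h3 _ hu _ hvA, fun hu => hu ▸ hvA⟩
              subst hAv
              refine ⟨I - 1 + k, ?_, by linarith, ?_⟩
              · refine dvdc (dvd_add hI (dvd_refl k)) ?_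
                simp [ins, hxA]; ring
              · simp [cr, hxA]; linarith
          · exact gd_mono 0 1 (hbigO A hA hz x hxA (hO x hxW)) (by simp [ins, hvA])
              (by simp [cr, hvA, hxA]) (by linarith) (by linarith)
          · exact gd_mono 0 0 (hG A hA hAn hz) (by simp [ins, hvA, hxA]) (by simp [cr, hvA, hxA])
              (by linarith) (by linarith)
    by_cases hnoO : ∀ v ∈ G.W, ¬ cO {v}
    · have hO : ∀ v ∈ G.W, cI {v} := fun v hv => (hor v hv).resolve_right (hnoO v hv)
      by_cases hpos : ∃ v ∈ G.W, 0 < G.i v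
      · obtain ⟨v, hv, hov⟩ := hpos
        apply sol_opIn (v := v) (q := -1)
        refine ihN _ hn ?_ ⟨valid_opIn hV hv (by linarith) ?_, hne, ?_⟩
        · rw [mu_opIn hv]; linarith
        · rcases hV.two with h | h
          · exact Or.inl ⟨by linarith [h.1], h.2⟩
          · exact Or.inr ⟨by linarith [h.1], h.2⟩
        · intro A hA hAn hz
          unfold Good
          rw [D_opIn, R_opIn]
          by_cases hvA : v ∈ A
          · exact gd_mono 1 0 (hbigI A hA hz v hvA (hO v hv)) (by simp [hvA]; ring) (by simp [hvA]; ring)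
              (by linarith) (by linarith)
          · exact gd_mono 0 0 (hG A hA hAn hz) (by simp [hvA]) (by simp [hvA]) (by linarith) (by linarith)
      · push Not at hpos
        have ho0 : ∑ v ∈ G.W, G.i v = 0 :=
          Finset.sum_eq_zero (fun v hv => le_antisymm (hpos v hv) (hV.hi v))
        obtain ⟨v, hv⟩ := hne
        obtain ⟨e, he, x, hj, hxv, hxW⟩ := hcutv v hv
        obtain ⟨I, hI, hl, hu⟩ := hGv v hv
        have hIk : I = G.D {v} - (k - 1) := by
          by_contra h
          exact hnoO v hv ⟨I, hI, hl, by omega⟩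
        have hDlt : G.D {v} < 3 * k - 2 := by
          by_contra h
          exact hnoO v hv ⟨I - k, dvdc (dvd_sub hI (dvd_refl k)) (by ring), by omega, by omega⟩
        have hDv := hexc v hv
        set q := 3 * k - 2 - G.D {v} with hq
        have hq1 : 1 ≤ q := by omega
        have hq2 : q ≤ k - 1 := by omega
        apply sol_opIn (v := v) (q := q)
        have he' : e ∈ (G.opIn v q).F := he
        have hj' : (G.opIn v q).Jn e v x := Jn.symm hj
        apply sol_opDel hj'
        refine ihN _ hn ?_ ⟨valid_opDel (valid_opIn hV hv (by linarith [hV.hi v]) ?_) hxW, ⟨v, hv⟩, ?_⟩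
        · rw [mu_opDel he' hj' hxv.symm, mu_opIn hv]; linarith
        · left; constructor
          · linarith
          · rcases hV.two with h | h <;> linarith [h.2]
        · intro A hA hAn hz
          unfold Good
          rw [D_opDel he' hj', R_opDel he' hj', D_opIn, R_opIn]
          by_cases hvA : v ∈ A <;> by_cases hxA : x ∈ A
          · exact gd_mono (-q) 0 (hG A hA hAn hz) (by simp [ins, hvA, hxA]) (by simp [cr, hvA, hxA])
              (by linarith) (by linarith)
          · by_cases h2 : 2 ≤ A.card
            · exact gd_mono (-q) 1 (hL A hA h2 hz) (by simp [ins, hvA, hxA])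
                (by simp [cr, hvA, hxA]) (by linarith) (by linarith)
            · have hAv : A = {v} := by
                have h3 : A.card ≤ 1 := by omega
                rw [Finset.card_le_one] at h3
                ext u; simp only [Finset.mem_singleton]
                exact ⟨fun hu => h3 _ hu _ hvA, fun hu => hu ▸ hvA⟩
              subst hAv
              refine ⟨I + q - k, ?_, by linarith, ?_⟩
              · refine dvdc (dvd_sub hI (dvd_refl k)) ?_
                simp [ins, hxA]; ring
              · simp [cr, hxA]; linarith
          · exact gd_mono 1 0 (hbigI A hA hz x hxA (hO x hxW)) (by simp [ins, hvA, hxA])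
              (by simp [cr, hvA, hxA]) (by linarith) (by linarith)
          · exact gd_mono 0 0 (hG A hA hAn hz) (by simp [ins, hvA, hxA]) (by simp [cr, hvA, hxA])
              (by linarith) (by linarith)
    push Not at hnoI hnoO
    obtain ⟨y0, hy0, hy0I⟩ := hnoI
    obtain ⟨x0, hx0, hx0O⟩ := hnoO
    have key : ∃ e ∈ G.F, ∃ x y, G.Jn e x y ∧ x ≠ y ∧ x ∈ G.W ∧ y ∈ G.W ∧ cO {x} ∧ cI {y} := by
      by_cases hall : ∀ v ∈ G.W, cO {v}
      · obtain ⟨e, he, x, hj, hxv, hxW⟩ := hcutv y0 hy0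
        exact ⟨e, he, x, y0, hj, hxv, hxW, hy0, hall x hxW, hy0I⟩
      · push Not at hall
        obtain ⟨w, hw, hwO⟩ := hall
        classical
        obtain ⟨e, he, y, x, hj, hy, hx⟩ := exists_cross (hcut (G.W.filter (fun v => cO {v}))
          (Finset.filter_subset _ _) ⟨x0, by simp [hx0, hx0O]⟩ ⟨w, hw, by simp [hwO]⟩)
        have hm := jn_mem hV he hj
        simp only [Finset.mem_filter, hm.1, hm.2, true_and] at hy hx
        refine ⟨e, he, x, y, hj.symm, fun h => hy (h ▸ hx), hm.2, hm.1, hx, (hor y hm.1).resolve_right hy⟩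
    obtain ⟨e, he, x, y, hj, hxy, hxW, hyW, hxO, hyI⟩ := key
    apply sol_opDel hj
    refine ihN _ hn ?_ ⟨valid_opDel hV hyW, hne, ?_⟩
    · rw [mu_opDel he hj hxy]; linarith
    · intro A hA hAn hz
      unfold Good
      rw [D_opDel he hj, R_opDel he hj]
      by_cases hyA : y ∈ A <;> by_cases hxA : x ∈ A
      · exact gd_mono 0 0 (hG A hA hAn hz) (by simp [ins, hyA, hxA]) (by simp [cr, hyA, hxA])
          (by linarith) (by linarith)
      · exact gd_mono 1 0 (hbigI A hA hz y hyA hyI) (by simp [ins, hyA, hxA]) (by simp [cr, hyA, hxA])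
          (by linarith) (by linarith)
      · exact gd_mono 0 1 (hbigO A hA hz x hxA hxO) (by simp [ins, hyA, hxA]) (by simp [cr, hyA, hxA])
          (by linarith) (by linarith)
      · exact gd_mono 0 0 (hG A hA hAn hz) (by simp [ins, hyA, hxA]) (by simp [cr, hyA, hxA])
          (by linarith) (by linarith)

theorem TP {k : ℤ} (hk : 3 ≤ k) (n : ℕ) : (∀ G : MI V E, G.W.card = n → ThyT k G → Sol k G) ∧
    (∀ G : MI V E, G.W.card = n → ∀ y m, ThyP k G y m → Sol k G) := by
  induction n using Nat.strong_induction_on with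
  | _ n ih =>
  have IH : ∀ H : MI V E, H.W.card < n → ThyT k H → Sol k H := fun H h => (ih _ h).1 H rfl
  have IHP : ∀ H : MI V E, H.W.card < n → ∀ y m, ThyP k H y m → Sol k H :=
    fun H h => (ih _ h).2 H rfl
  have hP : ∀ G : MI V E, G.W.card = n → ∀ y m, ThyP k G y m → Sol k G := by
    intro G hn y m hT
    have hm : 0 ≤ m := le_trans (hT.1.hi y) hT.2.2.2.2.2.1
    lift m to ℕ using hm
    exact P_thm (by linarith) n IH IHP m G hn y hT
  refine ⟨fun G hn hT => ?_, hP⟩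
  exact T_thm hk n IH hP ((mu k G).toNat + 1) G hn (by push_cast; have := Int.self_le_toNat (mu k G); linarith) hT

theorem T_final {k : ℤ} (hk : 3 ≤ k) (G : MI V E) (hT : ThyT k G) : Sol k G :=
  (TP hk _).1 G rfl hT

end MI

set_option linter.unusedSectionVars false

namespace Pack
variable {V E : Type} [DecidableEq V] [DecidableEq E]

def din (a b : E → V) (F : Finset E) (B : Finset V) : ℕ :=
  ∑ e ∈ F, if a e ∉ B ∧ b e ∈ B then 1 else 0

theorem din_pos {a b : E → V} {F : Finset E} {B : Finset V} (h : 1 ≤ din a b F B) :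
    ∃ e ∈ F, a e ∉ B ∧ b e ∈ B := by
  by_contra hc
  push Not at hc
  have : din a b F B = 0 := by
    apply Finset.sum_eq_zero
    intro e he
    rw [if_neg]
    rintro ⟨h1, h2⟩
    exact hc e he h1 h2
  omega

theorem pos_din {a b : E → V} {F : Finset E} {B : Finset V} {e : E} (he : e ∈ F)
    (h1 : a e ∉ B) (h2 : b e ∈ B) : 1 ≤ din a b F B := by
  have := Finset.single_le_sum (f := fun e => if a e ∉ B ∧ b e ∈ B then 1 else 0)
    (fun i _ => Nat.zero_le _) he
  simp only [h1, h2, not_false_eq_true, and_self, if_true] at this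
  exact this

theorem din_sdiff {a b : E → V} {F T : Finset E} (hT : T ⊆ F) (B : Finset V) :
    din a b (F \ T) B + din a b T B = din a b F B :=
  Finset.sum_sdiff hT

theorem din_sub {a b : E → V} (F : Finset E) (B C : Finset V) :
    din a b F (B ∩ C) + din a b F (B ∪ C) ≤ din a b F B + din a b F C := by
  unfold din
  rw [← Finset.sum_add_distrib, ← Finset.sum_add_distrib]
  apply Finset.sum_le_sum
  intro e _
  by_cases h1 : a e ∈ B <;> by_cases h2 : a e ∈ C <;> by_cases h3 : b e ∈ B <;>
    by_cases h4 : b e ∈ C <;> simp [h1, h2, h3, h4]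

theorem grow {a b : E → V} {F : Finset E} {U : Finset V} {r : V} {M : ℕ}
    (ha : ∀ e ∈ F, a e ∈ U) (hr : r ∈ U)
    (hM : ∀ B ⊆ U, B.Nonempty → r ∉ B → M + 1 ≤ din a b F B) :
    ∀ n : ℕ, ∀ (X : Finset V) (T : Finset E), (U \ X).card = n → X ⊆ U → r ∈ X → T ⊆ F →
      (∀ e ∈ T, b e ∈ X) →
      (∀ B ⊆ U, r ∉ B → (B ∩ X).Nonempty → 1 ≤ din a b T B) →
      (∀ B ⊆ U, B.Nonempty → r ∉ B → M ≤ din a b (F \ T) B) →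
      ∃ T ⊆ F, (∀ B ⊆ U, B.Nonempty → r ∉ B → 1 ≤ din a b T B) ∧
        (∀ B ⊆ U, B.Nonempty → r ∉ B → M ≤ din a b (F \ T) B) := by
  intro n
  induction n with
  | zero =>
    intro X T hn hX hrX hT hTX h1 h2
    have hUX : U ⊆ X := by
      rw [← Finset.sdiff_eq_empty_iff_subset]; exact Finset.card_eq_zero.mp hn
    refine ⟨T, hT, fun B hB hBn hrB => h1 B hB hrB ?_, h2⟩
    rwa [Finset.inter_eq_left.mpr (hB.trans hUX)]
  | succ n ih =>
    intro X T hn hX hrX hT hTX h1 h2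
    -- candidate family
    let fam := U.powerset.filter (fun B => (B \ X).Nonempty ∧
      (B = U ∨ (r ∉ B ∧ din a b (F \ T) B = M)))
    have hU : U ∈ fam := by
      simp only [fam, Finset.mem_filter, Finset.mem_powerset, subset_refl, true_or, and_true,
        true_and]
      rw [← Finset.card_pos]; omega
    obtain ⟨B, hBf, hmin⟩ := Finset.exists_min_image fam Finset.card ⟨U, hU⟩
    simp only [fam, Finset.mem_filter, Finset.mem_powerset] at hBf hmin
    obtain ⟨hBU, hBX, hB⟩ := hBf
    have hTB : ∀ C : Finset V, Disjoint C X → din a b T C = 0 := by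
      intro C hC
      apply Finset.sum_eq_zero
      intro e he
      rw [if_neg]
      rintro ⟨_, h⟩
      exact (Finset.disjoint_left.mp hC h) (hTX e he)
    have hdisj : Disjoint (B \ X) X := Finset.sdiff_disjoint
    have hBXd : M + 1 ≤ din a b (F \ T) (B \ X) := by
      have e1 := din_sdiff (a := a) (b := b) hT (B \ X)
      have e2 := hM (B \ X) (Finset.sdiff_subset.trans hBU) hBX (by simp [hrX])
      have e3 := hTB _ hdisj
      omega
    have harc : ∃ e ∈ F \ T, a e ∈ B ∧ a e ∈ X ∧ b e ∈ B ∧ b e ∉ X := by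
      by_contra hc
      push Not at hc
      rcases hB with hB | ⟨hrB, hB⟩
      · obtain ⟨e, he, h3, h4⟩ := din_pos (show 1 ≤ din a b (F \ T) (B \ X) by omega)
        have haU := ha e (Finset.mem_sdiff.mp he).1
        rw [← hB] at haU
        rw [Finset.mem_sdiff] at h4
        have : a e ∈ X := by
          by_contra h; exact h3 (Finset.mem_sdiff.mpr ⟨haU, h⟩)
        exact h4.2 (hc e he haU this h4.1)
      · have : din a b (F \ T) (B \ X) ≤ din a b (F \ T) B := by
          apply Finset.sum_le_sum
          intro e he
          by_cases hh : a e ∉ B \ X ∧ b e ∈ B \ X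
          · have h4 := Finset.mem_sdiff.mp hh.2
            have haB : a e ∉ B := by
              intro h5
              have : a e ∈ X := by
                by_contra h; exact hh.1 (Finset.mem_sdiff.mpr ⟨h5, h⟩)
              exact h4.2 (hc e he h5 this h4.1)
            rw [if_pos hh, if_pos ⟨haB, h4.1⟩]
          · rw [if_neg hh]; exact Nat.zero_le _
        omega
    obtain ⟨e, he, haB, haX, hbB, hbX⟩ := harc
    obtain ⟨heF, heT⟩ := Finset.mem_sdiff.mp he
    have hT' : insert e T ⊆ F := Finset.insert_subset heF hT
    have hbr : b e ≠ r := fun h => hbX (h ▸ hrX)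
    refine ih (insert (b e) X) (insert e T) ?_ (Finset.insert_subset (hBU hbB) hX)
      (Finset.mem_insert_of_mem hrX) hT' ?_ ?_ ?_
    · rw [Finset.sdiff_insert, Finset.card_erase_of_mem (Finset.mem_sdiff.mpr ⟨hBU hbB, hbX⟩)]
      omega
    · intro x hx
      rcases Finset.mem_insert.mp hx with rfl | hx
      · exact Finset.mem_insert_self _ _
      · exact Finset.mem_insert_of_mem (hTX x hx)
    · intro C hC hrC hCX
      by_cases hCX' : (C ∩ X).Nonempty
      · have := h1 C hC hrC hCX'
        have h5 : din a b T C ≤ din a b (insert e T) C :=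
          Finset.sum_le_sum_of_subset (Finset.subset_insert _ _)
        omega
      · obtain ⟨z, hz⟩ := hCX
        rw [Finset.mem_inter, Finset.mem_insert] at hz
        have hbC : b e ∈ C := by
          rcases hz.2 with h | h
          · exact h ▸ hz.1
          · exact absurd ⟨z, Finset.mem_inter.mpr ⟨hz.1, h⟩⟩ hCX'
        exact pos_din (Finset.mem_insert_self _ _)
          (fun h => hCX' ⟨a e, Finset.mem_inter.mpr ⟨h, haX⟩⟩) hbC
    · intro C hC hCn hrC
      have e1 := din_sdiff (a := a) (b := b) hT C
      have e2 := din_sdiff (a := a) (b := b) hT' C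
      have e3 : din a b (insert e T) C = (if a e ∉ C ∧ b e ∈ C then 1 else 0) + din a b T C :=
        Finset.sum_insert heT
      have e4 := h2 C hC hCn hrC
      by_cases hen : a e ∉ C ∧ b e ∈ C
      · rw [if_pos hen] at e3
        by_contra hlt
        have htight : din a b (F \ T) C = M := by omega
        rcases hB with hB | ⟨hrB, hB⟩
        · have := hmin C ⟨hC, ⟨b e, Finset.mem_sdiff.mpr ⟨hen.2, hbX⟩⟩, Or.inr ⟨hrC, htight⟩⟩
          rw [hB] at this
          have h6 : C = U := Finset.eq_of_subset_of_card_le hC this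
          exact hen.1 (h6 ▸ hBU haB)
        · have hs := din_sub (a := a) (b := b) (F \ T) B C
          have h7 := h2 (B ∪ C) (Finset.union_subset hBU hC) ⟨b e, Finset.mem_union_left _ hbB⟩
            (by simp [hrB, hrC])
          have hbBC : b e ∈ B ∩ C := Finset.mem_inter.mpr ⟨hbB, hen.2⟩
          have h8 := h2 (B ∩ C) (Finset.inter_subset_left.trans hBU) ⟨b e, hbBC⟩
            (by simp [hrB])
          have := hmin (B ∩ C) ⟨Finset.inter_subset_left.trans hBU,
            ⟨b e, Finset.mem_sdiff.mpr ⟨hbBC, hbX⟩⟩, Or.inr ⟨by simp [hrB], by omega⟩⟩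
          have h6 : B ∩ C = B := Finset.eq_of_subset_of_card_le Finset.inter_subset_left this
          rw [← h6] at haB
          exact hen.1 (Finset.mem_inter.mp haB).2
      · rw [if_neg hen] at e3; omega

theorem edmonds {a b : E → V} {U : Finset V} {r : V} (hr : r ∈ U) :
    ∀ (M : ℕ) (F : Finset E), (∀ e ∈ F, a e ∈ U) →
    (∀ B ⊆ U, B.Nonempty → r ∉ B → M ≤ din a b F B) →
    ∃ c : E → ℕ, ∀ j < M, ∀ B ⊆ U, B.Nonempty → r ∉ B →
      ∃ e ∈ F, a e ∉ B ∧ b e ∈ B ∧ c e = j := by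
  intro M
  induction M with
  | zero => intro F _ _; exact ⟨fun _ => 0, fun j hj => absurd hj (Nat.not_lt_zero j)⟩
  | succ M ih =>
    intro F ha hM
    obtain ⟨T, hT, h1, h2⟩ := grow ha hr hM _ {r} ∅ rfl (by simpa using hr) (by simp) (by simp)
      (by simp) (by
        intro B _ hrB hn
        obtain ⟨z, hz⟩ := hn
        simp only [Finset.mem_inter, Finset.mem_singleton] at hz
        exact absurd (hz.2 ▸ hz.1) hrB) (by
        intro B hB hBn hrB
        have := hM B hB hBn hrB
        simp only [Finset.sdiff_empty]; omega)
    obtain ⟨c, hc⟩ := ih (F \ T) (fun e he => ha e (Finset.mem_sdiff.mp he).1) h2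
    refine ⟨fun e => if e ∈ T then M else c e, ?_⟩
    intro j hj B hB hBn hrB
    by_cases hjM : j = M
    · obtain ⟨e, he, h3, h4⟩ := din_pos (h1 B hB hBn hrB)
      exact ⟨e, hT he, h3, h4, by simp [he, hjM]⟩
    · obtain ⟨e, he, h3, h4, h5⟩ := hc j (by omega) B hB hBn hrB
      obtain ⟨heF, heT⟩ := Finset.mem_sdiff.mp he
      exact ⟨e, heF, h3, h4, by simp [heT, h5]⟩

end Pack

set_option linter.unusedSectionVars false

namespace Pack
variable {V E : Type} [DecidableEq V] [DecidableEq E]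

theorem heads {s t : E → V} {F : Finset E} {U : Finset V} {r : V} {M : ℕ} (hr : r ∈ U)
    (hF : ∀ e ∈ F, s e ∈ U ∧ t e ∈ U)
    (hcard : M * (U.card - 1) ≤ F.card)
    (hsp : ∀ B ⊆ U, B.Nonempty → (F.filter (fun e => s e ∈ B ∧ t e ∈ B)).card ≤ M * (B.card - 1)) :
    ∃ h : E → V, (∀ e, h e = s e ∨ h e = t e) ∧
      ∀ v ∈ U, v ≠ r → M ≤ (F.filter (fun e => h e = v)).card := by
  classical
  let ι := {v // v ∈ U ∧ v ≠ r} × Fin M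
  let tt : ι → Finset E := fun p => F.filter (fun e => s e = p.1.1 ∨ t e = p.1.1)
  have hall : ∀ S : Finset ι, S.card ≤ (S.biUnion tt).card := by
    intro S
    let X : Finset V := S.image (fun p => p.1.1)
    have hXU : X ⊆ U := by
      intro v hv
      obtain ⟨p, _, rfl⟩ := Finset.mem_image.mp hv
      exact p.1.2.1
    have hrX : r ∉ X := by
      intro hv
      obtain ⟨p, _, hp⟩ := Finset.mem_image.mp hv
      exact p.1.2.2 hp
    have h1 : S.card ≤ M * X.card := by
      have hinj : Set.InjOn (fun p : ι => (p.1.1, p.2)) S := by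
        intro p _ q _ hpq
        simp only [Prod.mk.injEq] at hpq
        exact Prod.ext (Subtype.ext hpq.1) hpq.2
      have h2 : S.image (fun p : ι => (p.1.1, p.2)) ⊆ X ×ˢ (Finset.univ : Finset (Fin M)) := by
        intro q hq
        obtain ⟨p, hp, rfl⟩ := Finset.mem_image.mp hq
        simp only [Finset.mem_product, Finset.mem_univ, and_true]
        exact Finset.mem_image_of_mem _ hp
      have h3 := Finset.card_le_card h2
      rw [Finset.card_image_of_injOn hinj, Finset.card_product, Finset.card_univ,
        Fintype.card_fin] at h3
      rw [mul_comm]; exact h3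
    have h4 : F \ (F.filter (fun e => s e ∈ U \ X ∧ t e ∈ U \ X)) ⊆ S.biUnion tt := by
      intro e he
      simp only [Finset.mem_sdiff, Finset.mem_filter, not_and, Finset.mem_biUnion] at he ⊢
      obtain ⟨heF, he2⟩ := he
      have hX : s e ∈ X ∨ t e ∈ X := by
        by_contra hc
        push Not at hc
        exact he2 heF ⟨(hF e heF).1, hc.1⟩ (hF e heF).2 hc.2
      rcases hX with h | h
      · obtain ⟨p, hp, hpe⟩ := Finset.mem_image.mp h
        exact ⟨p, hp, Finset.mem_filter.mpr ⟨heF, Or.inl hpe.symm⟩⟩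
      · obtain ⟨p, hp, hpe⟩ := Finset.mem_image.mp h
        exact ⟨p, hp, Finset.mem_filter.mpr ⟨heF, Or.inr hpe.symm⟩⟩
    have h5 := Finset.card_le_card h4
    rw [Finset.card_sdiff_of_subset (Finset.filter_subset _ _)] at h5
    have h6 := hsp (U \ X) Finset.sdiff_subset ⟨r, Finset.mem_sdiff.mpr ⟨hr, hrX⟩⟩
    have h7 := Finset.card_sdiff_of_subset hXU
    have h8 : 1 ≤ (U \ X).card := Finset.card_pos.mpr ⟨r, Finset.mem_sdiff.mpr ⟨hr, hrX⟩⟩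
    have h9 := Finset.card_le_card hXU
    have h10 : M * (U.card - 1) = M * ((U \ X).card - 1) + M * X.card := by
      rw [← mul_add]; congr 1; omega
    omega
  obtain ⟨f, hfi, hft⟩ := (Finset.all_card_le_biUnion_card_iff_exists_injective tt).mp hall
  refine ⟨fun e => if h : ∃ p, f p = e then (Classical.choose h).1.1 else s e, ?_, ?_⟩
  · intro e
    dsimp only
    split_ifs with h
    · have h1 := Classical.choose_spec h
      have h2 := hft (Classical.choose h)
      rw [h1] at h2
      rcases (Finset.mem_filter.mp h2).2 with h3 | h3
      · exact Or.inl h3.symm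
      · exact Or.inr h3.symm
    · exact Or.inl rfl
  · intro v hv hvr
    have hsub : (Finset.univ : Finset (Fin M)).image (fun j => f (⟨v, hv, hvr⟩, j)) ⊆
        F.filter (fun e => (if h : ∃ p, f p = e then (Classical.choose h).1.1 else s e) = v) := by
      intro e he
      obtain ⟨j, _, rfl⟩ := Finset.mem_image.mp he
      rw [Finset.mem_filter]
      refine ⟨(Finset.mem_filter.mp (hft (⟨v, hv, hvr⟩, j))).1, ?_⟩
      have hex : ∃ p, f p = f (⟨v, hv, hvr⟩, j) := ⟨_, rfl⟩
      rw [dif_pos hex, hfi (Classical.choose_spec hex)]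
    have := Finset.card_le_card hsub
    rw [Finset.card_image_of_injective _ (by
      intro i j hij
      have := hfi hij
      exact (Prod.mk.inj this).2), Finset.card_univ, Fintype.card_fin] at this
    exact this

theorem inner {s t : E → V} {F : Finset E} {U : Finset V} {M : ℕ} (hU : U.Nonempty)
    (hF : ∀ e ∈ F, s e ∈ U ∧ t e ∈ U)
    (hcard : M * (U.card - 1) ≤ F.card)
    (hsp : ∀ B ⊆ U, B.Nonempty → (F.filter (fun e => s e ∈ B ∧ t e ∈ B)).card ≤ M * (B.card - 1)) :
    ∃ c : E → ℕ, ∀ j < M, ∀ A ⊆ U, A.Nonempty → A ≠ U →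
      ∃ e ∈ F, ¬ (s e ∈ A ↔ t e ∈ A) ∧ c e = j := by
  obtain ⟨r, hr⟩ := hU
  obtain ⟨h, hst, hh⟩ := heads hr hF hcard hsp
  let a : E → V := fun e => if h e = s e then t e else s e
  have key : ∀ (e : E) (B : Finset V), (a e ∉ B ∧ h e ∈ B) ↔ (¬ (s e ∈ B ∧ t e ∈ B) ∧ h e ∈ B) := by
    intro e B
    by_cases h1 : h e = s e
    · simp only [a, h1, if_true]; tauto
    · have h2 := (hst e).resolve_left h1
      simp only [a, if_neg h1]; rw [h2]; tauto
  have hent : ∀ B ⊆ U, B.Nonempty → r ∉ B → M ≤ din a h F B := by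
    intro B hB hBn hrB
    have e1 : din a h F B = (F.filter (fun e => ¬ (s e ∈ B ∧ t e ∈ B) ∧ h e ∈ B)).card := by
      unfold din
      rw [Finset.card_filter]
      apply Finset.sum_congr rfl
      intro e _
      simp only [key e B]
    have e2 : M * B.card ≤ (F.filter (fun e => h e ∈ B)).card := by
      have : (F.filter (fun e => h e ∈ B)).card = ∑ v ∈ B, (F.filter (fun e => h e = v)).card := by
        rw [Finset.card_eq_sum_card_fiberwise (f := h) (t := B)
          (s := F.filter (fun e => h e ∈ B)) (fun e he => (Finset.mem_filter.mp he).2)]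
        apply Finset.sum_congr rfl
        intro v hv
        rw [Finset.filter_filter]
        congr 1
        apply Finset.filter_congr
        intro e _
        constructor
        · exact fun h => h.2
        · exact fun h => ⟨h ▸ hv, h⟩
      rw [this, mul_comm]
      rw [← smul_eq_mul]
      apply Finset.card_nsmul_le_sum
      intro v hv
      exact hh v (hB hv) (fun h => hrB (h ▸ hv))
    have e3 : (F.filter (fun e => h e ∈ B)).card ≤
        (F.filter (fun e => ¬ (s e ∈ B ∧ t e ∈ B) ∧ h e ∈ B)).card +
        (F.filter (fun e => s e ∈ B ∧ t e ∈ B)).card := by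
      refine le_trans (Finset.card_le_card ?_) (Finset.card_union_le _ _)
      intro e he
      simp only [Finset.mem_union, Finset.mem_filter] at he ⊢
      tauto
    have e4 := hsp B hB hBn
    have e5 : 1 ≤ B.card := Finset.card_pos.mpr hBn
    have e6 : M * B.card = M * (B.card - 1) + M := by
      rw [← Nat.mul_succ]; congr 1; omega
    omega
  have haU : ∀ e ∈ F, a e ∈ U := by
    intro e he
    simp only [a]; split_ifs
    · exact (hF e he).2
    · exact (hF e he).1
  obtain ⟨c, hc⟩ := edmonds hr M F haU hent
  refine ⟨c, ?_⟩
  intro j hj A hA hAn hAU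
  by_cases hrA : r ∈ A
  · have hne : (U \ A).Nonempty := by
      rw [Finset.sdiff_nonempty]; exact fun h => hAU (Finset.Subset.antisymm hA h)
    obtain ⟨e, he, h1, h2, h3⟩ := hc j hj (U \ A) Finset.sdiff_subset hne (by simp [hrA])
    refine ⟨e, he, ?_, h3⟩
    have h4 := (key e (U \ A)).mp ⟨h1, h2⟩
    obtain ⟨hs, ht⟩ := hF e he
    simp only [Finset.mem_sdiff, hs, ht, true_and] at h4
    have h5 := hst e
    intro hiff
    rcases h5 with h5 | h5 <;> rw [h5] at h4 <;> tauto
  · obtain ⟨e, he, h1, h2, h3⟩ := hc j hj A hA hAn hrA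
    refine ⟨e, he, ?_, h3⟩
    have h4 := (key e A).mp ⟨h1, h2⟩
    have h5 := hst e
    intro hiff
    rcases h5 with h5 | h5 <;> rw [h5] at h4 <;> tauto

theorem pack {M : ℕ} {F : Finset E} :
    ∀ (n : ℕ) (s t : E → V) (W : Finset V), W.card ≤ n →
    (∀ e ∈ F, s e ∈ W ∧ t e ∈ W) →
    (∀ A ⊆ W, A.Nonempty → A ≠ W → 2 * M ≤ (F.filter (fun e => ¬ (s e ∈ A ↔ t e ∈ A))).card) →
    ∃ c : E → ℕ, ∀ j < M, ∀ A ⊆ W, A.Nonempty → A ≠ W →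
      ∃ e ∈ F, ¬ (s e ∈ A ↔ t e ∈ A) ∧ c e = j := by
  intro n
  induction n with
  | zero =>
    intro s t W hn _ _
    refine ⟨fun _ => 0, ?_⟩
    intro j _ A hA hAn _
    have := Finset.card_le_card hA
    have := Finset.card_pos.mpr hAn
    omega
  | succ n ih =>
    intro s t W hn hF hcut
    by_cases hW : W.card ≤ 1
    · refine ⟨fun _ => 0, ?_⟩
      intro j _ A hA hAn hAW
      have := Finset.card_pos.mpr hAn
      exact absurd (Finset.eq_of_subset_of_card_le hA (by omega)) hAW
    push Not at hW
    let L : Finset V → Finset E := fun B => F.filter (fun e => s e ≠ t e ∧ s e ∈ B ∧ t e ∈ B)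
    have hWL : M * (W.card - 1) ≤ (L W).card := by
      have h1 : ∑ v ∈ W, (F.filter (fun e => ¬ (s e ∈ ({v} : Finset V) ↔ t e ∈ ({v} : Finset V)))).card
          = 2 * (L W).card := by
        simp only [Finset.card_filter, L]
        rw [Finset.sum_comm, Finset.mul_sum]
        apply Finset.sum_congr rfl
        intro e he
        obtain ⟨hs, ht⟩ := hF e he
        by_cases hst : s e = t e
        · simp [hst]
        · rw [if_pos ⟨hst, hs, ht⟩]
          have : ∀ v ∈ W, (if ¬ (s e ∈ ({v} : Finset V) ↔ t e ∈ ({v} : Finset V)) then 1 else 0) =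
              (if s e = v then 1 else 0) + (if t e = v then 1 else 0) := by
            intro v _
            by_cases h1 : s e = v
            · have h2 : t e ≠ v := fun h => hst (h1.trans h.symm)
              simp [h1, h2]
            · by_cases h2 : t e = v <;> simp [h1, h2]
          rw [Finset.sum_congr rfl this, Finset.sum_add_distrib]
          simp [hs, ht]
      have h2 : W.card • (2 * M) ≤ ∑ v ∈ W, (F.filter (fun e => ¬ (s e ∈ ({v} : Finset V) ↔ t e ∈ ({v} : Finset V)))).card := by
        apply Finset.card_nsmul_le_sum
        intro v hv
        refine hcut {v} (by simpa using hv) (by simp) ?_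
        intro h
        rw [← h] at hW
        simp at hW
      rw [h1, smul_eq_mul] at h2
      have h3 : M * (W.card - 1) ≤ M * W.card := Nat.mul_le_mul_left _ (Nat.sub_le _ _)
      have h4 : W.card * (2 * M) = 2 * (M * W.card) := by ring
      omega
    let fam := W.powerset.filter (fun U => 2 ≤ U.card ∧ M * (U.card - 1) ≤ (L U).card)
    obtain ⟨U, hUf, hmin⟩ := Finset.exists_min_image fam Finset.card
      ⟨W, by simp only [fam, Finset.mem_filter, Finset.mem_powerset]; exact ⟨subset_refl _, hW, hWL⟩⟩
    simp only [fam, Finset.mem_filter, Finset.mem_powerset] at hUf hmin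
    obtain ⟨hUW, hU2, hUL⟩ := hUf
    obtain ⟨FU, hFU, hFUc⟩ := Finset.exists_subset_card_eq hUL
    have hUn : U.Nonempty := Finset.card_pos.mp (by omega)
    have hFUm : ∀ e ∈ FU, e ∈ F ∧ s e ≠ t e ∧ s e ∈ U ∧ t e ∈ U := fun e he =>
      Finset.mem_filter.mp (hFU he)
    obtain ⟨cU, hcU⟩ := inner (s := s) (t := t) (M := M) hUn (fun e he => (hFUm e he).2.2) hFUc.ge (by
      intro B hB hBn
      have hB1 := Finset.card_pos.mpr hBn
      by_cases hB2 : 2 ≤ B.card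
      · by_cases hBU : B = U
        · rw [hBU, ← hFUc]; exact Finset.card_filter_le _ _
        · by_contra hc
          push Not at hc
          have hsub : FU.filter (fun e => s e ∈ B ∧ t e ∈ B) ⊆ L B := by
            intro e he
            obtain ⟨h1, h2⟩ := Finset.mem_filter.mp he
            exact Finset.mem_filter.mpr ⟨(hFUm e h1).1, (hFUm e h1).2.1, h2⟩
          have := hmin B ⟨hB.trans hUW, hB2, (hc.le.trans (Finset.card_le_card hsub))⟩
          exact hBU (Finset.eq_of_subset_of_card_le hB this)
      · have : FU.filter (fun e => s e ∈ B ∧ t e ∈ B) = ∅ := by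
          apply Finset.filter_eq_empty_iff.mpr
          intro e he ⟨h1, h2⟩
          exact (hFUm e he).2.1 (Finset.card_le_one.mp (by omega) _ h1 _ h2)
        rw [this]; simp)
    obtain ⟨u0, hu0⟩ := hUn
    let φ : V → V := fun v => if v ∈ U then u0 else v
    let W' := insert u0 (W \ U)
    have hW'W : W' ⊆ W := Finset.insert_subset (hUW hu0) Finset.sdiff_subset
    have hφW : ∀ v ∈ W, φ v ∈ W' := by
      intro v hv
      simp only [φ, W']
      split_ifs with h
      · exact Finset.mem_insert_self _ _
      · exact Finset.mem_insert_of_mem (Finset.mem_sdiff.mpr ⟨hv, h⟩)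
    have hφid : ∀ v ∈ W', φ v = v := by
      intro v hv
      simp only [φ, W', Finset.mem_insert, Finset.mem_sdiff] at hv ⊢
      split_ifs with h
      · rcases hv with h1 | h1
        · exact h1.symm
        · exact absurd h h1.2
      · rfl
    have hcardW' : W'.card ≤ n := by
      have h1 := Finset.card_insert_le u0 (W \ U)
      have h2 := Finset.card_sdiff_of_subset hUW
      have h3 := Finset.card_le_card hUW
      simp only [W']
      omega
    obtain ⟨c', hc'⟩ := ih (φ ∘ s) (φ ∘ t) W' hcardW'
      (fun e he => ⟨hφW _ (hF e he).1, hφW _ (hF e he).2⟩) (by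
        intro A hA hAn hAW
        let Q := W.filter (fun v => φ v ∈ A)
        have h1 := hcut Q (Finset.filter_subset _ _) (by
          obtain ⟨z, hz⟩ := hAn
          exact ⟨z, Finset.mem_filter.mpr ⟨hW'W (hA hz), by rw [hφid z (hA hz)]; exact hz⟩⟩) (by
          intro h
          apply hAW
          apply Finset.Subset.antisymm hA
          intro z hz
          have : z ∈ Q := by rw [h]; exact hW'W hz
          have := (Finset.mem_filter.mp this).2
          rwa [hφid z hz] at this)
        refine h1.trans (Finset.card_le_card ?_)
        intro e he
        obtain ⟨heF, h2⟩ := Finset.mem_filter.mp he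
        refine Finset.mem_filter.mpr ⟨heF, ?_⟩
        simpa [Q, hF e heF] using h2)
    refine ⟨fun e => if s e ∈ U ∧ t e ∈ U then cU e else c' e, ?_⟩
    intro j hj A hA hAn hAW
    by_cases hsplit : (A ∩ U).Nonempty ∧ A ∩ U ≠ U
    · obtain ⟨e, he, h1, h2⟩ := hcU j hj (A ∩ U) Finset.inter_subset_right hsplit.1 hsplit.2
      obtain ⟨heF, _, hs, ht⟩ := hFUm e he
      refine ⟨e, heF, ?_, by simp [hs, ht, h2]⟩
      simpa [hs, ht] using h1
    · have hall : ∀ x ∈ U, ∀ y ∈ U, x ∈ A → y ∈ A := by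
        intro x hx y hy hxA
        by_contra hyA
        apply hsplit
        refine ⟨⟨x, Finset.mem_inter.mpr ⟨hxA, hx⟩⟩, fun h => hyA ?_⟩
        rw [← h] at hy
        exact (Finset.mem_inter.mp hy).1
      have hφA : ∀ v, φ v ∈ A ↔ v ∈ A := by
        intro v
        simp only [φ]
        split_ifs with h
        · exact ⟨hall _ hu0 _ h, hall _ h _ hu0⟩
        · rfl
      obtain ⟨e, heF, h1, h2⟩ := hc' j hj (W'.filter (· ∈ A)) (Finset.filter_subset _ _) (by
          obtain ⟨z, hz⟩ := hAn
          exact ⟨φ z, Finset.mem_filter.mpr ⟨hφW z (hA hz), (hφA z).mpr hz⟩⟩) (by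
          intro h
          apply hAW
          apply Finset.Subset.antisymm hA
          intro z hz
          have h3 := hφW z hz
          rw [← h] at h3
          exact (hφA z).mp (Finset.mem_filter.mp h3).2)
      have hs := hφW _ (hF e heF).1
      have ht := hφW _ (hF e heF).2
      have h3 : ¬ (s e ∈ A ↔ t e ∈ A) := by
        simpa [hs, ht, hφA] using h1
      refine ⟨e, heF, h3, ?_⟩
      dsimp only
      rw [if_neg, h2]
      rintro ⟨h4, h5⟩
      exact h3 ⟨hall _ h4 _ h5, hall _ h5 _ h4⟩

end Pack


namespace Fin2
open Classical in
theorem cut_of_conn {V : Type} [Fintype V] {G : SimpleGraph V} {n : ℕ}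
    {s t : Sym2 V → V} (hst : ∀ e, s(s e, t e) = e) {F : Finset (Sym2 V)}
    (hF : ∀ e, e ∈ F ↔ e ∈ G.edgeSet) (hc : IsKEdgeConnected G n)
    (A : Finset V) (hA : A.Nonempty) (hAu : A ≠ Finset.univ) :
    n ≤ (F.filter (fun e => ¬ (s e ∈ A ↔ t e ∈ A))).card := by
  by_contra hlt
  rw [not_le] at hlt
  have h := hc _ hlt
  obtain ⟨x, hx⟩ := hA
  obtain ⟨y, hy⟩ : ∃ y, y ∉ A := by
    by_contra hcon
    push Not at hcon
    exact hAu (Finset.eq_univ_iff_forall.mpr hcon)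
  obtain ⟨w⟩ := h.preconnected x y
  have key : ∀ u v, (G.deleteEdges ↑(F.filter (fun e => ¬ (s e ∈ A ↔ t e ∈ A)))).Walk u v →
      u ∈ A → v ∈ A := by
    intro u v w
    induction w with
    | nil => exact id
    | @cons a b c hab _ ih =>
      intro ha
      apply ih
      rw [SimpleGraph.deleteEdges_adj] at hab
      obtain ⟨h1, h2⟩ := hab
      by_contra hb
      apply h2
      rw [Finset.mem_coe, Finset.mem_filter]
      refine ⟨(hF _).mpr h1, ?_⟩
      have h3 := hst s(a, b)
      rw [Sym2.eq_iff] at h3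
      rcases h3 with ⟨h3, h4⟩ | ⟨h3, h4⟩ <;> rw [h3, h4] <;> tauto
  exact hy (key x y w hx)

open Classical in
theorem conn_of_cut {V : Type} [Fintype V] [Nonempty V] {G : SimpleGraph V} {n : ℕ}
    {s t : Sym2 V → V} (hst : ∀ e, s(s e, t e) = e) {F : Finset (Sym2 V)}
    (hF : ∀ e, e ∈ F ↔ e ∈ G.edgeSet)
    (hc : ∀ A : Finset V, A.Nonempty → A ≠ Finset.univ →
      n ≤ (F.filter (fun e => ¬ (s e ∈ A ↔ t e ∈ A))).card) : IsKEdgeConnected G n := by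
  intro S hS
  rw [SimpleGraph.connected_iff]
  refine ⟨?_, inferInstance⟩
  intro x y
  by_contra hxy
  let A : Finset V := Finset.univ.filter (fun z => (G.deleteEdges ↑S).Reachable x z)
  have hmem : ∀ z, z ∈ A ↔ (G.deleteEdges ↑S).Reachable x z := by simp [A]
  have h1 := hc A ⟨x, (hmem x).mpr (SimpleGraph.Reachable.refl x)⟩ (by
    intro h
    have : y ∈ A := by rw [h]; exact Finset.mem_univ y
    exact hxy ((hmem y).mp this))
  have h2 : F.filter (fun e => ¬ (s e ∈ A ↔ t e ∈ A)) ⊆ S := by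
    intro e he
    obtain ⟨heF, h3⟩ := Finset.mem_filter.mp he
    by_contra heS
    apply h3
    have hadj : (G.deleteEdges ↑S).Adj (s e) (t e) := by
      rw [SimpleGraph.deleteEdges_adj]
      refine ⟨?_, ?_⟩
      · rw [← SimpleGraph.mem_edgeSet, hst]; exact (hF e).mp heF
      · rw [hst]; exact_mod_cast heS
    rw [hmem, hmem]
    exact ⟨fun h => h.trans hadj.reachable, fun h => h.trans hadj.symm.reachable⟩
  have := Finset.card_le_card h2
  omega

open Classical in
theorem deg_eq {V : Type} [Fintype V] {G : SimpleGraph V}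
    {s t : Sym2 V → V} (hst : ∀ e, s(s e, t e) = e) {F : Finset (Sym2 V)}
    (hF : ∀ e, e ∈ F ↔ e ∈ G.edgeSet) (v : V) :
    (G.neighborSet v).ncard = (F.filter (fun e => s e = v ∨ t e = v)).card := by
  have h1 : (G.neighborSet v).ncard = G.degree v := by
    rw [Set.ncard_eq_toFinset_card']; rfl
  rw [h1, ← SimpleGraph.card_incidenceFinset_eq_degree]
  congr 1
  ext e
  rw [SimpleGraph.mem_incidenceFinset, Finset.mem_filter, hF]
  unfold SimpleGraph.incidenceSet
  simp only [Set.mem_ofPred_eq]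
  have : v ∈ e ↔ s e = v ∨ t e = v := by
    conv_lhs => rw [← hst e]
    rw [Sym2.mem_iff]
    constructor <;> rintro (h | h) <;> simp [h]
  rw [this]

open Classical in
theorem sum_bip {V E : Type} [Fintype V] {s t : E → V} (T : Finset E) (p : V → Prop)
    (hp : ∀ e ∈ T, (p (s e) ↔ ¬ p (t e))) :
    ∑ v : V, (if p v then ((T.filter (fun e => s e = v ∨ t e = v)).card : ℤ) else 0) = T.card := by
  have h1 : ∀ v : V, (if p v then ((T.filter (fun e => s e = v ∨ t e = v)).card : ℤ) else 0) =
      ∑ e ∈ T, ((if s e = v then (if p (s e) then 1 else 0) else 0) +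
        (if t e = v then (if p (t e) then 1 else 0) else 0)) := by
    intro v
    by_cases hv : p v
    · rw [if_pos hv, Finset.card_filter]
      push_cast
      apply Finset.sum_congr rfl
      intro e he
      have := hp e he
      by_cases h1 : s e = v
      · have h2 : t e ≠ v := by
          intro h2; rw [h1, h2] at this; tauto
        simp [h1, h2, hv]
      · by_cases h2 : t e = v <;> simp [h1, h2, hv]
    · rw [if_neg hv]
      symm
      apply Finset.sum_eq_zero
      intro e _
      by_cases h1 : s e = v <;> by_cases h2 : t e = v <;> simp [h1, h2, hv]
  rw [Finset.sum_congr rfl (fun v _ => h1 v), Finset.sum_comm]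
  have h2 : ∀ e ∈ T, ∑ v : V, ((if s e = v then (if p (s e) then (1:ℤ) else 0) else 0) +
        (if t e = v then (if p (t e) then 1 else 0) else 0)) = 1 := by
    intro e he
    rw [Finset.sum_add_distrib]
    simp only [Finset.sum_ite_eq, Finset.mem_univ, if_true]
    have := hp e he
    by_cases h : p (s e)
    · have h' := this.mp h
      simp [h, h']
    · have h' : p (t e) := by by_contra hh; exact h (this.mpr hh)
      simp [h, h']
  rw [Finset.sum_congr rfl h2]
  simp

theorem card_colors {E : Type} [DecidableEq E] (S : Finset E) (c : E → ℕ) (a b : ℕ)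
    (h : ∀ j, a ≤ j → j < b → ∃ e ∈ S, c e = j) : b - a ≤ S.card := by
  have h1 : Finset.Ico a b ⊆ S.image c := by
    intro j hj
    rw [Finset.mem_Ico] at hj
    obtain ⟨e, he, h2⟩ := h j hj.1 hj.2
    exact Finset.mem_image.mpr ⟨e, he, h2⟩
  have h2 := Finset.card_le_card h1
  rw [Nat.card_Ico] at h2
  exact h2.trans Finset.card_image_le

theorem gd_of_large {k R D : ℤ} (hk : 3 ≤ k) (hD : 3 * k - 2 ≤ D) : MI.gd k (k-1) (k-1) R D := by
  refine ⟨k - 1 + (R - (k - 1)) % k, ?_, ?_, ?_⟩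
  · have := Int.emod_add_mul_ediv (R - (k-1)) k
    exact ⟨-((R - (k-1)) / k), by linarith⟩
  · have := Int.emod_nonneg (R - (k-1)) (show k ≠ 0 by omega); omega
  · have := Int.emod_lt_of_pos (R - (k-1)) (show 0 < k by omega); omega

open Classical in
theorem orient {V E : Type} [Fintype V] [Nonempty V] {s t : E → V} (H : Finset E) (k : ℕ)
    (hk : 4 ≤ k) (P : V → ℤ) (hsum : (k:ℤ) ∣ ∑ v : V, P v - H.card)
    (hcut : ∀ A : Finset V, A.Nonempty → A ≠ Finset.univ →
      3 * k - 2 ≤ (H.filter (fun e => ¬ (s e ∈ A ↔ t e ∈ A))).card) :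
    ∃ h : E → V, (∀ e ∈ H, h e = s e ∨ h e = t e) ∧
      ∀ v, (k:ℤ) ∣ P v - (H.filter (fun e => h e = v)).card := by
  let I : MI V E := ⟨Finset.univ, H, s, t, P, fun _ => 0, fun _ => 0⟩
  have hT : MI.ThyT (k:ℤ) I := by
    refine ⟨⟨fun _ _ => Finset.mem_univ _, fun _ _ => Finset.mem_univ _, fun _ => le_refl _,
      fun _ => le_refl _, ?_, ?_⟩, Finset.univ_nonempty, ?_⟩
    · simpa [I] using hsum
    · left; simp [I]; omega
    · intro A _ hA hz
      obtain ⟨z, _, hz⟩ := hz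
      have h1 := hcut A hA (fun h => hz (h ▸ Finset.mem_univ z))
      apply gd_of_large (by omega)
      have h2 : I.D A = (H.filter (fun e => ¬ (s e ∈ A ↔ t e ∈ A))).card := by
        simp only [MI.D, I, MI.cr, Finset.card_filter]
        push_cast
        simp only [add_zero, Finset.sum_const_zero]
        apply Finset.sum_congr rfl
        intro e _
        by_cases h : (s e ∈ A ↔ t e ∈ A) <;> simp [h]
      rw [h2]
      omega
  obtain ⟨h, h1, h2⟩ := MI.T_final (by omega) I hT
  refine ⟨h, h1, fun v => ?_⟩
  have h3 := h2 v (Finset.mem_univ v)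
  refine MI.dvdc h3 ?_
  simp only [I, Finset.card_filter]
  push_cast
  ring

theorem head_iff {V : Type} (p : V → Prop) {x y w v : V} (hb : p x ↔ ¬ p y)
    (hw : w = x ∨ w = y) (hv : p v) : (p w ∧ (x = v ∨ y = v)) ↔ w = v := by
  constructor
  · rintro ⟨h4, h5 | h5⟩
    · subst h5
      rcases hw with h6 | h6
      · exact h6
      · subst h6; exact absurd h4 (hb.mp hv)
    · subst h5
      rcases hw with h6 | h6
      · subst h6; exact absurd hv (hb.mp h4)
      · exact h6
  · intro h4
    subst h4
    refine ⟨hv, ?_⟩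
    rcases hw with h6 | h6
    · exact Or.inl h6.symm
    · exact Or.inr h6.symm

end Fin2

set_option maxHeartbeats 1000000 in
/-- Let `k ≥ 4` be even and `r` a natural number.  If `G` is a `(6k-4+4r)`-edge-connected
bipartite finite graph with vertex classes `A₁` (the set `A`) and `A₂ = Aᶜ`, and `|E(G)|`
is divisible by `k`, then `G` decomposes into two spanning `r`-edge-connected subgraphs
`G₁`, `G₂` such that the degree in `Gᵢ` of every vertex of `Aᵢ` is divisible by `k`. -/
theorem bipartite_decomposition_into_edge_connected_parts_even
    {V : Type} [Fintype V] (k r : ℕ) (hk4 : 4 ≤ k) (hkeven : Even k)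
    (G : SimpleGraph V) (A : Set V)
    (hbip : ∀ u v, G.Adj u v → (u ∈ A ↔ v ∉ A))
    (hconn : IsKEdgeConnected G (6 * k - 4 + 4 * r))
    (hdiv : k ∣ G.edgeSet.ncard) :
    ∃ G₁ G₂ : SimpleGraph V,
      G₁ ⊔ G₂ = G ∧ Disjoint G₁.edgeSet G₂.edgeSet ∧
      IsKEdgeConnected G₁ r ∧ IsKEdgeConnected G₂ r ∧
      (∀ v ∈ A, k ∣ (G₁.neighborSet v).ncard) ∧
      (∀ v ∉ A, k ∣ (G₂.neighborSet v).ncard) := by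
  classical
  have hne : Nonempty V := (hconn ∅ (by simp; omega)).nonempty
  have hex : ∀ e : Sym2 V, ∃ p : V × V, s(p.1, p.2) = e := by
    intro e
    induction e using Sym2.ind with
    | _ x y => exact ⟨(x, y), rfl⟩
  choose st hst' using hex
  let s : Sym2 V → V := fun e => (st e).1
  let t : Sym2 V → V := fun e => (st e).2
  have hst : ∀ e, s(s e, t e) = e := hst'
  obtain ⟨F, hF⟩ : ∃ F : Finset (Sym2 V), ∀ e, e ∈ F ↔ e ∈ G.edgeSet :=
    ⟨(Set.toFinite G.edgeSet).toFinset, by simp⟩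
  have hFc : F.card = G.edgeSet.ncard := by
    have : (F : Set (Sym2 V)) = G.edgeSet := by ext e; simp [hF]
    rw [← this, Set.ncard_coe_finset]
  have hb : ∀ e ∈ F, (s e ∈ A ↔ ¬ t e ∈ A) := by
    intro e he
    apply hbip
    rw [← SimpleGraph.mem_edgeSet, hst]
    exact (hF e).mp he
  have hcut := Fin2.cut_of_conn hst hF hconn
  obtain ⟨c, hc⟩ := Pack.pack (M := 3 * k - 2 + 2 * r) (F := F) _ s t Finset.univ le_rfl
    (fun _ _ => ⟨Finset.mem_univ _, Finset.mem_univ _⟩) (by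
      intro B _ hB hBu
      have := hcut B hB hBu
      omega)
  let T₁ := F.filter (fun e => c e < r)
  let T₂ := F.filter (fun e => r ≤ c e ∧ c e < 2 * r)
  let H := F.filter (fun e => 2 * r ≤ c e)
  have cut1 : ∀ B : Finset V, B.Nonempty → B ≠ Finset.univ →
      r ≤ (T₁.filter (fun e => ¬ (s e ∈ B ↔ t e ∈ B))).card := by
    intro B hB hBu
    have := Fin2.card_colors (T₁.filter (fun e => ¬ (s e ∈ B ↔ t e ∈ B))) c 0 r (by
      intro j _ hj
      obtain ⟨e, he, h1, h2⟩ := hc j (by omega) B (Finset.subset_univ _) hB hBu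
      exact ⟨e, by simp only [T₁, Finset.mem_filter]; exact ⟨⟨he, by omega⟩, h1⟩, h2⟩)
    omega
  have cut2 : ∀ B : Finset V, B.Nonempty → B ≠ Finset.univ →
      r ≤ (T₂.filter (fun e => ¬ (s e ∈ B ↔ t e ∈ B))).card := by
    intro B hB hBu
    have := Fin2.card_colors (T₂.filter (fun e => ¬ (s e ∈ B ↔ t e ∈ B))) c r (2 * r) (by
      intro j _ hj
      obtain ⟨e, he, h1, h2⟩ := hc j (by omega) B (Finset.subset_univ _) hB hBu
      exact ⟨e, by simp only [T₂, Finset.mem_filter]; exact ⟨⟨he, by omega⟩, h1⟩, h2⟩)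
    omega
  have cutH : ∀ B : Finset V, B.Nonempty → B ≠ Finset.univ →
      3 * k - 2 ≤ (H.filter (fun e => ¬ (s e ∈ B ↔ t e ∈ B))).card := by
    intro B hB hBu
    have := Fin2.card_colors (H.filter (fun e => ¬ (s e ∈ B ↔ t e ∈ B))) c (2 * r)
      (3 * k - 2 + 2 * r) (by
      intro j _ hj
      obtain ⟨e, he, h1, h2⟩ := hc j (by omega) B (Finset.subset_univ _) hB hBu
      exact ⟨e, by simp only [H, Finset.mem_filter]; exact ⟨⟨he, by omega⟩, h1⟩, h2⟩)
    omega
  have hT₁F : ∀ e ∈ T₁, e ∈ F := fun e he => (Finset.mem_filter.mp he).1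
  have hT₂F : ∀ e ∈ T₂, e ∈ F := fun e he => (Finset.mem_filter.mp he).1
  have hHF : ∀ e ∈ H, e ∈ F := fun e he => (Finset.mem_filter.mp he).1
  have hcards : T₁.card + T₂.card + H.card = F.card := by
    simp only [T₁, T₂, H, Finset.card_filter]
    rw [← Finset.sum_add_distrib, ← Finset.sum_add_distrib, Finset.card_eq_sum_ones]
    apply Finset.sum_congr rfl
    intro e _
    split_ifs <;> omega
  let P : V → ℤ := fun v =>
    -(if v ∈ A then ((T₁.filter (fun e => s e = v ∨ t e = v)).card : ℤ) else 0)
    - (if v ∉ A then ((T₂.filter (fun e => s e = v ∨ t e = v)).card : ℤ) else 0)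
  have hsum : (k:ℤ) ∣ ∑ v : V, P v - H.card := by
    have e1 := Fin2.sum_bip (s := s) (t := t) T₁ (fun v => v ∈ A) (fun e he => hb e (hT₁F e he))
    have e2 := Fin2.sum_bip (s := s) (t := t) T₂ (fun v => v ∉ A)
      (fun e he => by have := hb e (hT₂F e he); tauto)
    have e3 : ∑ v : V, P v = -(T₁.card : ℤ) - T₂.card := by
      simp only [P]
      rw [Finset.sum_sub_distrib, Finset.sum_neg_distrib, e1, ← e2]
      congr 1
      refine Finset.sum_congr rfl (fun v _ => ?_)
      congr
    have e4 : (k:ℤ) ∣ (F.card : ℤ) := by rw [hFc]; exact_mod_cast hdiv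
    refine MI.dvdc (dvd_neg.mpr e4) ?_
    rw [e3, ← hcards]; push_cast; ring
  obtain ⟨h, hh, hd⟩ := Fin2.orient (s := s) (t := t) H k hk4 P hsum cutH
  let S₁ := T₁ ∪ H.filter (fun e => h e ∈ A)
  let S₂ := T₂ ∪ H.filter (fun e => h e ∉ A)
  have hS₁F : ∀ e ∈ S₁, e ∈ F := by
    intro e he
    rcases Finset.mem_union.mp he with h1 | h1
    · exact hT₁F e h1
    · exact hHF e (Finset.mem_filter.mp h1).1
  have hS₂F : ∀ e ∈ S₂, e ∈ F := by
    intro e he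
    rcases Finset.mem_union.mp he with h1 | h1
    · exact hT₂F e h1
    · exact hHF e (Finset.mem_filter.mp h1).1
  have hdiag : ∀ e ∈ F, ¬ e.IsDiag := fun e he => G.not_isDiag_of_mem_edgeSet ((hF e).mp he)
  have hE₁ : ∀ e, e ∈ S₁ ↔ e ∈ (SimpleGraph.fromEdgeSet (S₁ : Set (Sym2 V))).edgeSet := by
    intro e
    rw [SimpleGraph.edgeSet_fromEdgeSet]
    constructor
    · intro he; exact ⟨he, hdiag e (hS₁F e he)⟩
    · intro he; exact he.1
  have hE₂ : ∀ e, e ∈ S₂ ↔ e ∈ (SimpleGraph.fromEdgeSet (S₂ : Set (Sym2 V))).edgeSet := by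
    intro e
    rw [SimpleGraph.edgeSet_fromEdgeSet]
    constructor
    · intro he; exact ⟨he, hdiag e (hS₂F e he)⟩
    · intro he; exact he.1
  have hunion : ∀ e, e ∈ F → e ∈ S₁ ∨ e ∈ S₂ := by
    intro e he
    simp only [S₁, S₂, T₁, T₂, H, Finset.mem_union, Finset.mem_filter]
    by_cases h1 : c e < r
    · exact Or.inl (Or.inl ⟨he, h1⟩)
    · by_cases h2 : c e < 2 * r
      · exact Or.inr (Or.inl ⟨he, by omega, h2⟩)
      · by_cases h3 : h e ∈ A
        · exact Or.inl (Or.inr ⟨⟨he, by omega⟩, h3⟩)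
        · exact Or.inr (Or.inr ⟨⟨he, by omega⟩, h3⟩)
  have hdisj : ∀ e, e ∈ S₁ → e ∈ S₂ → False := by
    intro e h1 h2
    simp only [S₁, S₂, T₁, T₂, H, Finset.mem_union, Finset.mem_filter] at h1 h2
    rcases h1 with h1 | h1 <;> rcases h2 with h2 | h2
    · omega
    · omega
    · omega
    · exact h2.2 h1.2
  refine ⟨SimpleGraph.fromEdgeSet S₁, SimpleGraph.fromEdgeSet S₂, ?_, ?_, ?_, ?_, ?_, ?_⟩
  · rw [← SimpleGraph.edgeSet_inj]
    ext e
    rw [SimpleGraph.edgeSet_sup, Set.mem_union, ← hE₁, ← hE₂, ← hF]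
    exact ⟨fun h => h.elim (hS₁F e) (hS₂F e), hunion e⟩
  · rw [Set.disjoint_left]
    intro e h1 h2
    exact hdisj e ((hE₁ e).mpr h1) ((hE₂ e).mpr h2)
  · apply Fin2.conn_of_cut hst hE₁
    intro B hB hBu
    exact (cut1 B hB hBu).trans (Finset.card_le_card
      (Finset.filter_subset_filter _ Finset.subset_union_left))
  · apply Fin2.conn_of_cut hst hE₂
    intro B hB hBu
    exact (cut2 B hB hBu).trans (Finset.card_le_card
      (Finset.filter_subset_filter _ Finset.subset_union_left))
  · intro v hv
    rw [Fin2.deg_eq hst hE₁ v]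
    have e1 : S₁.filter (fun e => s e = v ∨ t e = v) =
        T₁.filter (fun e => s e = v ∨ t e = v) ∪ H.filter (fun e => h e = v) := by
      ext e
      simp only [S₁, Finset.mem_filter, Finset.mem_union]
      by_cases heH : e ∈ H
      · have h1 := hb e (hHF e heH)
        have h2 := hh e heH
        have h3 : (h e ∈ A ∧ (s e = v ∨ t e = v)) ↔ h e = v := by
          exact Fin2.head_iff (fun v => v ∈ A) h1 h2 hv
        tauto
      · tauto
    have e2 : Disjoint (T₁.filter (fun e => s e = v ∨ t e = v)) (H.filter (fun e => h e = v)) := by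
      rw [Finset.disjoint_left]
      intro e h1 h2
      simp only [T₁, H, Finset.mem_filter] at h1 h2
      omega
    rw [e1, Finset.card_union_of_disjoint e2]
    have e3 := hd v
    simp only [P, not_true_eq_false, if_false, hv] at e3
    rw [← Int.natCast_dvd_natCast]
    refine MI.dvdc (dvd_neg.mpr e3) ?_
    push_cast; ring
  · intro v hv
    rw [Fin2.deg_eq hst hE₂ v]
    have e1 : S₂.filter (fun e => s e = v ∨ t e = v) =
        T₂.filter (fun e => s e = v ∨ t e = v) ∪ H.filter (fun e => h e = v) := by
      ext e
      simp only [S₂, Finset.mem_filter, Finset.mem_union]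
      by_cases heH : e ∈ H
      · have h1 := hb e (hHF e heH)
        have h2 := hh e heH
        have h3 : (h e ∉ A ∧ (s e = v ∨ t e = v)) ↔ h e = v := by
          exact Fin2.head_iff (fun v => v ∉ A) (by tauto) h2 hv
        tauto
      · tauto
    have e2 : Disjoint (T₂.filter (fun e => s e = v ∨ t e = v)) (H.filter (fun e => h e = v)) := by
      rw [Finset.disjoint_left]
      intro e h1 h2
      simp only [T₂, H, Finset.mem_filter] at h1 h2
      omega
    rw [e1, Finset.card_union_of_disjoint e2]
    have e3 := hd v
    simp only [P, not_false_eq_true, if_true, if_false, hv] at e3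
    rw [← Int.natCast_dvd_natCast]
    refine MI.dvdc (dvd_neg.mpr e3) ?_
    push_cast; ring
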